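/- arXiv:1904.09196 — 2 statements merged into one kernel-verified Lean document; each statement's English description precedes it below -/
import Mathlib

section
/- The following two statements are equivalent: (i) for every integer $n > 2$, $\gcd(!n, n!) = 2$; (ii) there is no odd prime $p$ such that $p$ divides $!p$. -/
/-- The left factorials `!n` with `m ≤ n` are all congruent modulo a divisor of `m!`. -/
lemma sum_range_factorial_modEq {d m n : ℕ} (hd : d ∣ m.factorial) (h : m ≤ n) :
    ∑ i ∈ Finset.range n, i.factorial ≡ ∑ i ∈ Finset.range m, i.factorial [MOD d] := by
  induction n, h using Nat.le_induction with
  | base => rfl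
  | succ k hk ih =>
    rw [Finset.sum_range_succ]
    exact ih.add (Nat.modEq_zero_iff_dvd.2 (hd.trans (Nat.factorial_dvd_factorial hk)))

/-- Kurepa's conjecture equivalence: `gcd(!n, n!) = 2` for all integers `n > 2`
if and only if there is no odd prime `p` dividing `!p`, where
`!n = 0! + 1! + ⋯ + (n-1)!` is the left factorial. -/
theorem kurepa_equiv :
    (∀ n : ℕ, 2 < n →
        Nat.gcd (∑ i ∈ Finset.range n, i.factorial) n.factorial = 2) ↔
      ¬ ∃ p : ℕ, p.Prime ∧ Odd p ∧ p ∣ ∑ i ∈ Finset.range p, i.factorial := by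
  constructor
  · rintro h ⟨p, hp, hodd, hdvd⟩
    have hp2 : 2 < p := lt_of_le_of_ne hp.two_le (by rintro rfl; exact absurd hodd (by decide))
    have h2 : p ∣ 2 := h p hp2 ▸ Nat.dvd_gcd hdvd (Nat.dvd_factorial hp.pos le_rfl)
    exact absurd (Nat.le_of_dvd two_pos h2) (by omega)
  · intro h n hn
    obtain rfl | hn4 : n = 3 ∨ 4 ≤ n := by omega
    · decide
    have hmod : (∑ i ∈ Finset.range n, i.factorial) % 4 = 2 :=
      sum_range_factorial_modEq (d := 4) (m := 4) (by decide) hn4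
    have hdvd : 2 ∣ Nat.gcd (∑ i ∈ Finset.range n, i.factorial) n.factorial :=
      Nat.dvd_gcd (by omega) (Nat.dvd_factorial two_pos hn.le)
    obtain ⟨m, hm⟩ := hdvd
    have hsum : 2 * m ∣ ∑ i ∈ Finset.range n, i.factorial := hm ▸ Nat.gcd_dvd_left _ _
    have hfac : 2 * m ∣ n.factorial := hm ▸ Nat.gcd_dvd_right _ _
    have hm_odd : Odd m := by
      rw [← Nat.not_even_iff_odd]
      rintro ⟨k, rfl⟩
      have h4 : 4 ∣ ∑ i ∈ Finset.range n, i.factorial :=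
        Dvd.dvd.trans ⟨k, by ring⟩ hsum
      omega
    by_cases hm1 : m = 1
    · rw [hm, hm1]
    obtain ⟨p, hp, hpm⟩ := Nat.exists_prime_and_dvd hm1
    have hpm2 : p ∣ 2 * m := hpm.mul_left 2
    have hpn : p ≤ n := hp.dvd_factorial.1 (hpm2.trans hfac)
    refine absurd ⟨p, hp, hm_odd.of_dvd_nat hpm, ?_⟩ h
    exact ((sum_range_factorial_modEq (Nat.dvd_factorial hp.pos le_rfl) hpn).dvd_iff
      dvd_rfl).1 (hpm2.trans hsum)
end

section
/- The prime $p = 39\,541\,338\,091$ satisfies $!p \equiv -1 \pmod p$; that is, $p$ divides $!p + 1$. -/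
open Finset
open scoped Nat

namespace LeftFactorial

/-- The number with lanes `f 0, …, f (n - 1)`, each `90` bits wide. -/
def pack (n : ℕ) (f : ℕ → ℕ) : ℕ := ∑ i ∈ range n, f i * 2 ^ (90 * i)

section Pack

variable {n m t : ℕ} {f g : ℕ → ℕ}

theorem pack_congr (h : ∀ i < n, f i = g i) : pack n f = pack n g :=
  sum_congr rfl fun i hi => by rw [h i (mem_range.1 hi)]

theorem pack_succ (n : ℕ) (f : ℕ → ℕ) : pack (n + 1) f = pack n f + f n * 2 ^ (90 * n) :=
  sum_range_succ _ _

theorem pack_succ' (n : ℕ) (f : ℕ → ℕ) :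
    pack (n + 1) f = 2 ^ 90 * pack n (fun i => f (i + 1)) + f 0 := by
  have h : ∑ i ∈ range n, f (i + 1) * 2 ^ (90 * (i + 1)) =
      2 ^ 90 * ∑ i ∈ range n, f (i + 1) * 2 ^ (90 * i) := by
    rw [mul_sum]
    exact sum_congr rfl fun i _ => by rw [mul_add 90, pow_add, mul_one]; ring
  rw [pack, sum_range_succ', pack, h, mul_zero, pow_zero, mul_one]

theorem pack_append (n m : ℕ) (f : ℕ → ℕ) :
    pack (n + m) f = pack n f + 2 ^ (90 * n) * pack m (fun i => f (n + i)) := by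
  simp only [pack, sum_range_add, mul_sum]
  refine congr_arg _ (sum_congr rfl fun i _ => ?_)
  rw [mul_add 90, pow_add]
  ring

theorem pack_lt (h : ∀ i < n, f i < 2 ^ 90) : pack n f < 2 ^ (90 * n) := by
  induction n with
  | zero => simp [pack]
  | succ n ih =>
    rw [pack_succ, mul_add 90, pow_add]
    have h1 := ih fun i hi => h i (by omega)
    have h2 : (f n + 1) * 2 ^ (90 * n) ≤ 2 ^ 90 * 2 ^ (90 * n) :=
      Nat.mul_le_mul_right _ (h n (by omega))
    rw [mul_one, mul_comm (2 ^ (90 * n))]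
    linarith

theorem pack_add : pack n f + pack n g = pack n (fun i => f i + g i) := by
  simp only [pack, ← sum_add_distrib, add_mul]

theorem pack_mul (c : ℕ) : pack n f * c = pack n (fun i => f i * c) := by
  simp only [pack, sum_mul]
  exact sum_congr rfl fun i _ => by ring

theorem pack_sub (h : ∀ i < n, g i ≤ f i) : pack n f - pack n g = pack n (fun i => f i - g i) := by
  rw [Nat.sub_eq_iff_eq_add, pack_add]
  · exact pack_congr fun i hi => (Nat.sub_add_cancel (h i hi)).symm
  · exact sum_le_sum fun i hi => Nat.mul_le_mul_right _ (h i (mem_range.1 hi))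

theorem pack_shiftLeft (t : ℕ) : pack n f <<< t = pack n (fun i => f i * 2 ^ t) := by
  rw [Nat.shiftLeft_eq, pack_mul]

theorem pack_shiftRight (h : ∀ i < n, 2 ^ t ∣ f i) :
    pack n f >>> t = pack n (fun i => f i / 2 ^ t) := by
  rw [Nat.shiftRight_eq_div_pow]
  refine Nat.div_eq_of_eq_mul_left (by positivity) ?_
  rw [pack_mul]
  exact pack_congr fun i hi => (Nat.div_mul_cancel (h i hi)).symm

theorem pack_zero_extend (h : n ≤ m) (hf : ∀ i, n ≤ i → f i = 0) : pack n f = pack m f := by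
  obtain ⟨k, rfl⟩ := Nat.exists_eq_add_of_le h
  have hk : pack k (fun i => f (n + i)) = 0 :=
    sum_eq_zero fun i _ => by simp only [hf (n + i) (by omega), zero_mul]
  rw [pack_append, hk, mul_zero, add_zero]

theorem pack_mod (h : n ≤ m) (hf : ∀ i < n, f i < 2 ^ 90) :
    pack m f % 2 ^ (90 * n) = pack n f := by
  obtain ⟨k, rfl⟩ := Nat.exists_eq_add_of_le h
  rw [pack_append, Nat.add_mul_mod_self_left, Nat.mod_eq_of_lt (pack_lt hf)]

theorem pack_shiftRight_lanes (h : n ≤ m) (hf : ∀ i < n, f i < 2 ^ 90) :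
    pack m f >>> (90 * n) = pack (m - n) (fun i => f (n + i)) := by
  obtain ⟨k, rfl⟩ := Nat.exists_eq_add_of_le h
  rw [Nat.shiftRight_eq_div_pow, pack_append, Nat.add_mul_div_left _ _ (by positivity),
    Nat.div_eq_of_lt (pack_lt hf), zero_add, Nat.add_sub_cancel_left]

theorem mul_two_pow_add_land {a b : ℕ} (k x y : ℕ) (ha : a < 2 ^ k) (hb : b < 2 ^ k) :
    (2 ^ k * x + a) &&& (2 ^ k * y + b) = 2 ^ k * (x &&& y) + (a &&& b) := by
  refine Nat.eq_of_testBit_eq fun i => ?_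
  have hab : a &&& b < 2 ^ k := Nat.and_lt_two_pow a hb
  simp only [Nat.testBit_and, Nat.testBit_two_pow_mul_add _ ha, Nat.testBit_two_pow_mul_add _ hb,
    Nat.testBit_two_pow_mul_add _ hab]
  split_ifs <;> rfl

theorem pack_land (h : n ≤ m) (hf : ∀ i < n, f i < 2 ^ 90) (hg : ∀ i < m, g i < 2 ^ 90) :
    pack n f &&& pack m g = pack n (fun i => f i &&& g i) := by
  induction n generalizing m f g with
  | zero => simp [pack]
  | succ n ih =>
    obtain ⟨k, rfl⟩ := Nat.exists_eq_add_of_le' (Nat.succ_le_of_lt (by omega : 0 < m))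
    rw [pack_succ', pack_succ' k, pack_succ' n,
      mul_two_pow_add_land _ _ _ (hf 0 (by omega)) (hg 0 (by omega)),
      ih (by omega) (fun i hi => hf _ (by omega)) fun i hi => hg _ (by omega)]

theorem sum_range_mul_sum_range (x : ℕ) (hf : ∀ i, n ≤ i → f i = 0) (hg : ∀ i, m ≤ i → g i = 0) :
    (∑ i ∈ range n, f i * x ^ i) * ∑ i ∈ range m, g i * x ^ i =
      ∑ j ∈ range (n + m), (∑ i ∈ range (j + 1), f i * g (j - i)) * x ^ j := by
  have key : ∀ (k : ℕ) (h : ℕ → ℕ), (∀ i, k ≤ i → h i = 0) →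
      ∃ P : Polynomial ℕ, (∀ i, P.coeff i = h i) ∧ P.eval x = ∑ i ∈ range k, h i * x ^ i := by
    intro k h hh
    refine ⟨∑ i ∈ range k, Polynomial.monomial i (h i), fun i => ?_, ?_⟩
    · simp only [Polynomial.finsetSum_coeff, Polynomial.coeff_monomial, sum_ite_eq', mem_range]
      split_ifs with hi
      · rfl
      · exact (hh i (by omega)).symm
    · simp [Polynomial.eval_finsetSum]
  obtain ⟨P, hP, hPx⟩ := key n f hf
  obtain ⟨Q, hQ, hQx⟩ := key m g hg
  have hPQ : ∀ j, (P * Q).coeff j = ∑ i ∈ range (j + 1), f i * g (j - i) := fun j => by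
    rw [Polynomial.coeff_mul, Nat.sum_antidiagonal_eq_sum_range_succ_mk]
    simp only [hP, hQ]
  obtain ⟨R, hR, hRx⟩ := key (n + m) (fun j => ∑ i ∈ range (j + 1), f i * g (j - i)) fun j hj =>
    sum_eq_zero fun i _ => by
      rcases le_or_gt n i with hi | hi
      · rw [hf i hi, zero_mul]
      · rw [hg _ (by omega), mul_zero]
  rw [← hPx, ← hQx, ← hRx, ← Polynomial.eval_mul]
  congr 1
  ext j
  rw [hPQ, hR]

theorem pack_mul_pack (hf : ∀ i, n ≤ i → f i = 0) (hg : ∀ i, m ≤ i → g i = 0) :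
    pack n f * pack m g = pack (n + m) (fun j => ∑ i ∈ range (j + 1), f i * g (j - i)) := by
  simp only [pack, pow_mul]
  exact sum_range_mul_sum_range _ hf hg

end Pack

/-- The number of lanes of the longest vectors. -/
def blocks : ℕ := 204800

/-- `x` moved up by `n` lanes. -/
def up (x n : ℕ) : ℕ := Nat.shiftLeft (Nat.shiftLeft x (Nat.mul 45 n)) (Nat.mul 45 n)

/-- The first `n` lanes of `x`. -/
def trunc (n x : ℕ) : ℕ := Nat.land x (Nat.sub (up 1 n) 1)

/-- The vector of `n` lanes equal to `1`. -/
def onesVec (n : ℕ) : ℕ := Nat.div (Nat.sub (up 1 n) 1) (2 ^ 90 - 1)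

/-- The vector of `blocks` lanes equal to `1`. -/
def ones : ℕ := onesVec blocks

/-- Lanewise, the lanes of `x` modulo `39541338091` up to an error below `2 ^ 53`. -/
def reduceHigh (x : ℕ) : ℕ :=
  Nat.sub x (Nat.mul (Nat.shiftRight (Nat.land (Nat.mul (Nat.shiftRight
    (Nat.land x (Nat.mul ones (2 ^ 90 - 2 ^ 52))) 52) (2 ^ 86 / 39541338091))
    (Nat.mul ones (2 ^ 90 - 2 ^ 34))) 34) 39541338091)

/-- Lanewise, the lanes of `x` brought from below `2 ^ 53` to below `2 ^ 36`. -/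
def reduceLow (x : ℕ) : ℕ :=
  Nat.sub x (Nat.mul (Nat.shiftRight (Nat.land (Nat.mul (Nat.shiftRight
    (Nat.land x (Nat.mul ones (2 ^ 90 - 2 ^ 17))) 17) (2 ^ 70 / 39541338091))
    (Nat.mul ones (2 ^ 90 - 2 ^ 53))) 53) 39541338091)

/-- Lanewise Barrett reduction modulo `39541338091`, with results below `2 ^ 36`. -/
def reduce (x : ℕ) : ℕ := reduceLow (reduceHigh x)

/-- Lanewise product of `x` and `y`, one bit of `y` at a time. -/
def laneMul (x y : ℕ) : ℕ :=
  Nat.rec 0 (fun t acc => Nat.add acc (Nat.land (Nat.mul (Nat.land y (Nat.shiftLeft ones t))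
    (2 ^ 36 - 1)) (Nat.shiftLeft x t))) 36

theorem up_eq (x n : ℕ) : up x n = 2 ^ (90 * n) * x := by
  change (x <<< (45 * n)) <<< (45 * n) = _
  rw [← Nat.shiftLeft_add, Nat.shiftLeft_eq, ← add_mul, mul_comm]

theorem trunc_eq (n x : ℕ) : trunc n x = x % 2 ^ (90 * n) := by
  change x &&& (up 1 n - 1) = _
  rw [up_eq, mul_one, Nat.and_two_pow_sub_one_eq_mod]

theorem pack_one_mul (n : ℕ) : pack n (fun _ => 1) * (2 ^ 90 - 1) = 2 ^ (90 * n) - 1 := by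
  induction n with
  | zero => simp [pack]
  | succ n ih =>
    have := Nat.one_le_two_pow (n := 90 * n)
    rw [pack_succ, add_mul, ih, mul_add 90, pow_add]
    omega

theorem onesVec_eq (n : ℕ) : onesVec n = pack n (fun _ => 1) := by
  change (up 1 n - 1) / (2 ^ 90 - 1) = _
  rw [up_eq, mul_one, ← pack_one_mul, Nat.mul_div_cancel _ (by norm_num)]

theorem ones_eq : ones = pack blocks (fun _ => 1) := onesVec_eq blocks

section

variable {n m : ℕ} {f g : ℕ → ℕ}

theorem pack_land_ones_mul {c : ℕ} (hn : n ≤ blocks) (hf : ∀ i < n, f i < 2 ^ 90)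
    (hc : c < 2 ^ 90) : Nat.land (pack n f) (Nat.mul ones c) = pack n (fun i => f i &&& c) := by
  change pack n f &&& (ones * c) = _
  rw [ones_eq, pack_mul, pack_land hn hf fun _ _ => by rwa [one_mul]]
  simp only [one_mul]

theorem land_mask {x t : ℕ} (ht : t ≤ 90) (hx : x < 2 ^ 90) :
    x &&& (2 ^ 90 - 2 ^ t) = x / 2 ^ t * 2 ^ t := by
  obtain ⟨k, hk⟩ := Nat.exists_eq_add_of_le ht
  have h1 : (2 : ℕ) ^ 90 - 2 ^ t = 2 ^ t * (2 ^ k - 1) + 0 := by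
    rw [hk, pow_add, Nat.mul_sub, mul_one, add_zero]
  have h2 : x / 2 ^ t < 2 ^ k := by
    rw [Nat.div_lt_iff_lt_mul (by positivity), ← pow_add, add_comm k, ← hk]
    exact hx
  conv_lhs => rw [h1, ← Nat.div_add_mod x (2 ^ t)]
  rw [mul_two_pow_add_land _ _ _ (Nat.mod_lt _ (by positivity)) (by positivity),
    Nat.and_two_pow_sub_one_eq_mod, Nat.mod_eq_of_lt h2, Nat.and_zero, add_zero, mul_comm]

theorem pack_field {t : ℕ} (ht : t ≤ 90) (hn : n ≤ blocks) (hf : ∀ i < n, f i < 2 ^ 90) :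
    Nat.shiftRight (Nat.land (pack n f) (Nat.mul ones (2 ^ 90 - 2 ^ t))) t =
      pack n (fun i => f i / 2 ^ t) := by
  rw [pack_land_ones_mul hn hf (Nat.sub_lt (by positivity) (by positivity)),
    pack_congr fun i hi => land_mask ht (hf i hi)]
  refine (pack_shiftRight fun i _ => dvd_mul_left _ _).trans (pack_congr fun i _ => ?_)
  exact Nat.mul_div_cancel _ (by positivity)

theorem reduceHigh_pack (hn : n ≤ blocks) (hf : ∀ i < n, f i < 2 ^ 90) : reduceHigh (pack n f) =
    pack n (fun i => f i - f i / 2 ^ 52 * (2 ^ 86 / 39541338091) / 2 ^ 34 * 39541338091) := by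
  rw [reduceHigh, pack_field (by norm_num) hn hf]
  change pack n f - Nat.shiftRight (Nat.land (pack n _ * _) _) 34 * _ = _
  rw [pack_mul, pack_field (by norm_num) hn, pack_mul, pack_sub]
  · intro i hi
    have := hf i hi
    omega
  · intro i hi
    have := hf i hi
    omega

theorem reduceLow_pack (hn : n ≤ blocks) (hf : ∀ i < n, f i < 2 ^ 53) : reduceLow (pack n f) =
    pack n (fun i => f i - f i / 2 ^ 17 * (2 ^ 70 / 39541338091) / 2 ^ 53 * 39541338091) := by
  rw [reduceLow, pack_field (by norm_num) hn fun i hi => (hf i hi).trans (by norm_num)]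
  change pack n f - Nat.shiftRight (Nat.land (pack n _ * _) _) 53 * _ = _
  rw [pack_mul, pack_field (by norm_num) hn, pack_mul, pack_sub]
  · intro i hi
    have := hf i hi
    omega
  · intro i hi
    have := hf i hi
    omega

theorem exists_reduce_pack (hn : n ≤ blocks) (hf : ∀ i < n, f i < 2 ^ 90) :
    ∃ g : ℕ → ℕ, reduce (pack n f) = pack n g ∧
      ∀ i < n, g i < 2 ^ 36 ∧ g i ≡ f i [MOD 39541338091] := by
  rw [reduce, reduceHigh_pack hn hf, reduceLow_pack hn]
  · refine ⟨_, rfl, fun i hi => ⟨?_, ?_⟩⟩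
    · have := hf i hi
      omega
    · have := hf i hi
      show _ % _ = _ % _
      omega
  · intro i hi
    have := hf i hi
    omega

theorem mod_two_pow_succ_eq (y t : ℕ) :
    y % 2 ^ (t + 1) = y % 2 ^ t + (y.testBit t).toNat * 2 ^ t := by
  rw [Nat.mod_pow_succ, Nat.toNat_testBit, mul_comm (2 ^ t)]

theorem land_bit {x y : ℕ} (t : ℕ) (hx : x < 2 ^ 36) :
    (y &&& 2 ^ t) * (2 ^ 36 - 1) &&& x * 2 ^ t = x * (y % 2 ^ (t + 1)) - x * (y % 2 ^ t) := by
  rw [Nat.and_two_pow, mul_comm x, mod_two_pow_succ_eq, Nat.mul_add, Nat.add_sub_cancel_left,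
    mul_comm _ (2 ^ t), mul_assoc, Nat.mul_comm x]
  have := mul_two_pow_add_land (a := 0) (b := 0) t ((y.testBit t).toNat * (2 ^ 36 - 1)) x
    (by positivity) (by positivity)
  simp only [add_zero, Nat.and_zero] at this
  rw [this, mul_assoc]
  congr 1
  cases y.testBit t
  · simp
  · rw [Bool.toNat_true, one_mul, one_mul, Nat.and_comm, Nat.and_two_pow_sub_one_eq_mod,
      Nat.mod_eq_of_lt hx]

theorem laneMul_pack (hn : n ≤ m) (hm : m ≤ blocks) (hf : ∀ i < n, f i < 2 ^ 36)
    (hg : ∀ i < m, g i < 2 ^ 36) :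
    laneMul (pack n f) (pack m g) = pack n (fun i => f i * g i) := by
  have key : ∀ k ≤ 36, Nat.rec (motive := fun _ => ℕ) 0 (fun t acc => Nat.add acc (Nat.land
      (Nat.mul (Nat.land (pack m g) (Nat.shiftLeft ones t)) (2 ^ 36 - 1))
      (Nat.shiftLeft (pack n f) t))) k = pack n (fun i => f i * (g i % 2 ^ k)) := by
    intro k
    induction k with
    | zero => simp [pack, Nat.mod_one]
    | succ t ih =>
      intro ht
      have hones : Nat.shiftLeft ones t = Nat.mul ones (2 ^ t) := Nat.shiftLeft_eq _ _
      have ht2 : (2 : ℕ) ^ t ≤ 2 ^ 35 := Nat.pow_le_pow_right (by norm_num) (by omega)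
      dsimp only
      rw [ih (by omega), hones, pack_land_ones_mul hm (fun i hi => (hg i hi).trans (by norm_num))
        (ht2.trans_lt (by norm_num))]
      change pack n _ + ((pack m _ * (2 ^ 36 - 1)) &&& (pack n f <<< t)) = _
      rw [pack_mul, pack_shiftLeft, Nat.and_comm, pack_land hn, pack_add]
      · refine pack_congr fun i hi => ?_
        rw [Nat.and_comm, land_bit t (hf i hi), Nat.add_sub_cancel']
        refine Nat.mul_le_mul_left _ ?_
        rw [mod_two_pow_succ_eq]
        exact Nat.le_add_right _ _
      · intro i hi
        calc f i * 2 ^ t < 2 ^ 36 * 2 ^ t := Nat.mul_lt_mul_of_pos_right (hf i hi) (by positivity)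
          _ ≤ 2 ^ 36 * 2 ^ 35 := Nat.mul_le_mul_left _ ht2
          _ < 2 ^ 90 := by norm_num
      · intro i _
        have : g i &&& 2 ^ t ≤ 2 ^ t := Nat.and_le_right
        omega
  rw [laneMul, key 36 le_rfl]
  exact pack_congr fun i hi => by rw [Nat.mod_eq_of_lt (hg i (by omega))]

end

/-- `k n`, with `n` brought to normal form first. -/
def seqEval (n : ℕ) (k : ℕ → ℕ) : ℕ := Nat.rec (k 0) (fun m _ => k (Nat.succ m)) n

theorem seqEval_eq (n : ℕ) (k : ℕ → ℕ) : seqEval n k = k n := by cases n <;> rfl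

/-- The vector of `c + 1` lanes `u, u * b, u * b * (b + 1), …` modulo `39541338091`. -/
def risingLeaf (b u c : ℕ) : ℕ :=
  Nat.rec u (fun i X => Nat.add X (Nat.shiftLeft (Nat.mod (Nat.mul
    (Nat.shiftRight X (Nat.mul 90 i)) (Nat.add b i)) 39541338091) (Nat.mul 90 (Nat.succ i)))) c

/-- The vector of `25 * 2 ^ l` lanes `u, u * b, u * b * (b + 1), …` modulo `39541338091`. -/
def risingVec (l : ℕ) : ℕ → ℕ → ℕ :=
  Nat.rec (fun b u => risingLeaf b u 24)
    (fun l ih b u => seqEval (ih b u) fun X => seqEval (Nat.add b (Nat.shiftLeft 25 l)) fun b' =>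
      seqEval (Nat.mod (Nat.mul (Nat.shiftRight X (Nat.mul 90 (Nat.pred (Nat.shiftLeft 25 l))))
        (Nat.pred b')) 39541338091) fun u' =>
      Nat.add X (up (ih b' u') (Nat.shiftLeft 25 l))) l

/-- `risingLeaf` with the lanes in reverse order. -/
def risingRevLeaf (b u c : ℕ) : ℕ :=
  Nat.rec u (fun i X => Nat.add (Nat.shiftLeft X 90) (Nat.mod (Nat.mul
    (Nat.land X (2 ^ 90 - 1)) (Nat.add b i)) 39541338091)) c

/-- `risingVec` with the lanes in reverse order. -/
def risingRevVec (l : ℕ) : ℕ → ℕ → ℕ :=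
  Nat.rec (fun b u => risingRevLeaf b u 24)
    (fun l ih b u => seqEval (ih b u) fun X => seqEval (Nat.add b (Nat.shiftLeft 25 l)) fun b' =>
      seqEval (Nat.mod (Nat.mul (Nat.land X (2 ^ 90 - 1)) (Nat.pred b')) 39541338091) fun u' =>
      Nat.add (up X (Nat.shiftLeft 25 l)) (ih b' u')) l

/-- The vector of the first `c + 1` products `u, u * y₀, u * y₀ * y₁, …` modulo `39541338091`,
for the lanes `yᵢ` of `Y`. -/
def scanLeaf (Y u c : ℕ) : ℕ :=
  Nat.rec u (fun i X => Nat.add X (Nat.shiftLeft (Nat.mod (Nat.mul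
    (Nat.shiftRight X (Nat.mul 90 i))
    (Nat.land (Nat.shiftRight Y (Nat.mul 90 i)) (2 ^ 90 - 1))) 39541338091)
    (Nat.mul 90 (Nat.succ i)))) c

/-- The vector of the first `25 * 2 ^ l` products `u, u * y₀, u * y₀ * y₁, …` modulo
`39541338091`, for the lanes `yᵢ` of `Y`. -/
def scanVec (l : ℕ) : ℕ → ℕ → ℕ :=
  Nat.rec (fun Y u => scanLeaf Y u 24)
    (fun l ih Y u => seqEval (trunc (Nat.shiftLeft 25 l) Y) fun Y₀ => seqEval (ih Y₀ u) fun X =>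
      seqEval (Nat.mod (Nat.mul
        (Nat.shiftRight X (Nat.mul 90 (Nat.pred (Nat.shiftLeft 25 l))))
        (Nat.shiftRight Y₀ (Nat.mul 90 (Nat.pred (Nat.shiftLeft 25 l))))) 39541338091) fun u' =>
      Nat.add X (up (ih (Nat.shiftRight Y (Nat.mul 90 (Nat.shiftLeft 25 l))) u')
        (Nat.shiftLeft 25 l))) l

/-- Lane `n` of `x`. -/
def lane (x n : ℕ) : ℕ := Nat.shiftRight (trunc (Nat.succ n) x) (Nat.mul 90 n)

/-- The vector of `2 * m` lanes `0, 1, 0, 1, …`. -/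
def oddOnesVec (m : ℕ) : ℕ :=
  Nat.shiftLeft (Nat.div (Nat.sub (up 1 (Nat.mul 2 m)) 1) (2 ^ 180 - 1)) 90

/-- The vector of `blocks` lanes `0, 1, 0, 1, …`. -/
def oddOnes : ℕ := oddOnesVec 102400

/-- `x` with its odd lanes negated modulo `39541338091`. -/
def flipOdd (x : ℕ) : ℕ :=
  Nat.sub (Nat.add x (Nat.mul oddOnes 39541338091))
    (Nat.mul 2 (Nat.land x (Nat.mul oddOnes (2 ^ 90 - 1))))

/-- The running products `u, u * m 0, u * m 0 * m 1, …` modulo `39541338091`. -/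
def runProd (m : ℕ → ℕ) (u : ℕ) : ℕ → ℕ
  | 0 => u
  | i + 1 => runProd m u i * m i % 39541338091

section

variable {n k u b : ℕ} {m f : ℕ → ℕ}

theorem runProd_add (m : ℕ → ℕ) (u n j : ℕ) :
    runProd m u (n + j) = runProd (fun i => m (n + i)) (runProd m u n) j := by
  induction j with
  | zero => rfl
  | succ j ih => rw [← add_assoc, runProd, ih, runProd]

theorem runProd_lt (hu : u < 39541338091) : ∀ i, runProd m u i < 39541338091
  | 0 => hu
  | _ + 1 => Nat.mod_lt _ (by norm_num)

theorem runProd_lt_pow (hu : u < 39541338091) (i : ℕ) : runProd m u i < 2 ^ 90 :=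
  (runProd_lt hu i).trans (by norm_num)

theorem pack_one (f : ℕ → ℕ) : pack 1 f = f 0 := by simp [pack]

theorem pack_add_up (n k : ℕ) (f : ℕ → ℕ) :
    pack n f + up (pack k fun i => f (n + i)) n = pack (n + k) f := by
  rw [up_eq, pack_append]

theorem pack_last (n : ℕ) (hf : ∀ i < n, f i < 2 ^ 90) : pack (n + 1) f >>> (90 * n) = f n := by
  rw [pack_shiftRight_lanes (Nat.le_add_right n 1) hf, Nat.add_sub_cancel_left, pack_one,
    add_zero]

theorem pack_last' (hn : 0 < n) (hf : ∀ i < n, f i < 2 ^ 90) :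
    Nat.shiftRight (pack n f) (Nat.mul 90 (Nat.pred n)) = f (n - 1) := by
  obtain ⟨k, rfl⟩ := Nat.exists_eq_add_of_le' hn
  exact pack_last k fun i hi => hf i (by omega)

theorem pack_first (hn : 0 < n) (hf : f 0 < 2 ^ 90) : Nat.land (pack n f) (2 ^ 90 - 1) = f 0 := by
  change pack n f &&& (2 ^ 90 - 1) = f 0
  have := pack_mod (n := 1) (f := f) hn fun i hi => by rwa [Nat.lt_one_iff.1 hi]
  rw [Nat.and_two_pow_sub_one_eq_mod, ← pack_one f, ← this]

theorem pack_rev_add (n k : ℕ) (f : ℕ → ℕ) :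
    up (pack n fun t => f (n - 1 - t)) k + (pack k fun t => f (n + (k - 1 - t))) =
      pack (n + k) fun t => f (n + k - 1 - t) := by
  rw [add_comm n k, pack_append, up_eq, add_comm]
  refine congr_arg₂ _ (pack_congr fun t ht => ?_) (congr_arg _ (pack_congr fun t ht => ?_))
  · congr 1
    omega
  · congr 1
    omega

theorem risingLeaf_eq (hu : u < 39541338091) (c : ℕ) :
    risingLeaf b u c = pack (c + 1) (runProd (fun i => b + i) u) := by
  induction c with
  | zero => exact (pack_one _).symm
  | succ c ih =>
    change risingLeaf b u c + ((risingLeaf b u c >>> (90 * c)) * (b + c) % 39541338091) <<<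
      (90 * (c + 1)) = _
    rw [ih, pack_last _ fun i _ => runProd_lt_pow hu i, Nat.shiftLeft_eq, pack_succ (c + 1)]
    rfl

theorem block_pos (l : ℕ) : 0 < 25 * 2 ^ l := by positivity

theorem two_mul_block (l : ℕ) : 25 * 2 ^ (l + 1) = 25 * 2 ^ l + 25 * 2 ^ l := by
  rw [pow_succ]
  ring

theorem risingVec_succ (l b u : ℕ) : risingVec (l + 1) b u =
    Nat.add (risingVec l b u) (up (risingVec l (Nat.add b (Nat.shiftLeft 25 l))
      (Nat.mod (Nat.mul (Nat.shiftRight (risingVec l b u)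
        (Nat.mul 90 (Nat.pred (Nat.shiftLeft 25 l))))
        (Nat.pred (Nat.add b (Nat.shiftLeft 25 l)))) 39541338091)) (Nat.shiftLeft 25 l)) := by
  have h : risingVec (l + 1) b u = seqEval (risingVec l b u) fun X =>
      seqEval (Nat.add b (Nat.shiftLeft 25 l)) fun b' =>
      seqEval (Nat.mod (Nat.mul (Nat.shiftRight X (Nat.mul 90 (Nat.pred (Nat.shiftLeft 25 l))))
        (Nat.pred b')) 39541338091) fun u' =>
      Nat.add X (up (risingVec l b' u') (Nat.shiftLeft 25 l)) := rfl
  rw [h, seqEval_eq, seqEval_eq, seqEval_eq]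

theorem risingVec_eq (l : ℕ) (hu : u < 39541338091) :
    risingVec l b u = pack (25 * 2 ^ l) (runProd (fun i => b + i) u) := by
  induction l generalizing b u with
  | zero =>
    have h : risingVec 0 b u = risingLeaf b u 24 := rfl
    rw [h, risingLeaf_eq hu, pow_zero, mul_one]
  | succ l ih =>
    have hn := block_pos l
    have h25 : Nat.shiftLeft 25 l = 25 * 2 ^ l := Nat.shiftLeft_eq _ _
    have hlast : runProd (fun i => b + i) u (25 * 2 ^ l - 1) * (b + 25 * 2 ^ l).pred %
        39541338091 = runProd (fun i => b + i) u (25 * 2 ^ l) := by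
      obtain ⟨n, hn'⟩ := Nat.exists_eq_add_of_le' hn
      rw [hn']
      rfl
    rw [risingVec_succ]
    change risingVec l b u + up (risingVec l (b + Nat.shiftLeft 25 l)
      (Nat.shiftRight (risingVec l b u) (Nat.mul 90 (Nat.pred (Nat.shiftLeft 25 l))) *
        (b + Nat.shiftLeft 25 l).pred % 39541338091)) (Nat.shiftLeft 25 l) = _
    rw [h25, ih hu, pack_last' hn fun i _ => runProd_lt_pow hu i, hlast, ih (runProd_lt hu _),
      two_mul_block, ← pack_add_up]
    simp only [runProd_add, add_assoc]

theorem risingRevLeaf_eq (hu : u < 39541338091) (c : ℕ) :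
    risingRevLeaf b u c = pack (c + 1) fun t => runProd (fun i => b + i) u (c - t) := by
  induction c with
  | zero => exact (pack_one _).symm
  | succ c ih =>
    change (risingRevLeaf b u c <<< 90) + (Nat.land (risingRevLeaf b u c) (2 ^ 90 - 1)) * (b + c) %
      39541338091 = _
    rw [ih, pack_first (f := fun t => runProd (fun i => b + i) u (c - t)) (Nat.succ_pos c)
      (runProd_lt_pow hu _), Nat.shiftLeft_eq,
      pack_succ' (c + 1), mul_comm]
    simp only [Nat.add_sub_add_right]
    rfl

theorem risingRevVec_succ (l b u : ℕ) : risingRevVec (l + 1) b u =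
    Nat.add (up (risingRevVec l b u) (Nat.shiftLeft 25 l))
      (risingRevVec l (Nat.add b (Nat.shiftLeft 25 l))
        (Nat.mod (Nat.mul (Nat.land (risingRevVec l b u) (2 ^ 90 - 1))
          (Nat.pred (Nat.add b (Nat.shiftLeft 25 l)))) 39541338091)) := by
  have h : risingRevVec (l + 1) b u = seqEval (risingRevVec l b u) fun X =>
      seqEval (Nat.add b (Nat.shiftLeft 25 l)) fun b' =>
      seqEval (Nat.mod (Nat.mul (Nat.land X (2 ^ 90 - 1)) (Nat.pred b')) 39541338091) fun u' =>
      Nat.add (up X (Nat.shiftLeft 25 l)) (risingRevVec l b' u') := rfl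
  rw [h, seqEval_eq, seqEval_eq, seqEval_eq]

theorem risingRevVec_eq (l : ℕ) (hu : u < 39541338091) : risingRevVec l b u =
    pack (25 * 2 ^ l) fun t => runProd (fun i => b + i) u (25 * 2 ^ l - 1 - t) := by
  induction l generalizing b u with
  | zero => exact risingRevLeaf_eq hu 24
  | succ l ih =>
    have hn := block_pos l
    have h25 : Nat.shiftLeft 25 l = 25 * 2 ^ l := Nat.shiftLeft_eq _ _
    have hlast : runProd (fun i => b + i) u (25 * 2 ^ l - 1) * (b + 25 * 2 ^ l).pred %
        39541338091 = runProd (fun i => b + i) u (25 * 2 ^ l) := by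
      obtain ⟨n, hn'⟩ := Nat.exists_eq_add_of_le' hn
      rw [hn']
      rfl
    rw [risingRevVec_succ]
    change up (risingRevVec l b u) (Nat.shiftLeft 25 l) + risingRevVec l (b + Nat.shiftLeft 25 l)
      (Nat.land (risingRevVec l b u) (2 ^ 90 - 1) *
        (b + Nat.shiftLeft 25 l).pred % 39541338091) = _
    rw [h25, ih hu, pack_first (f := fun t => runProd (fun i => b + i) u (25 * 2 ^ l - 1 - t)) hn
      (runProd_lt_pow hu _), Nat.sub_zero, hlast, ih (runProd_lt hu _), two_mul_block,
      ← pack_rev_add]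
    simp only [runProd_add, add_assoc]

theorem scanLeaf_eq (hu : u < 39541338091) (hf : ∀ i < n, f i < 2 ^ 90) (c : ℕ) (hc : c < n) :
    scanLeaf (pack n f) u c = pack (c + 1) (runProd f u) := by
  induction c with
  | zero => exact (pack_one _).symm
  | succ c ih =>
    change scanLeaf (pack n f) u c + ((scanLeaf (pack n f) u c >>> (90 * c)) *
      (Nat.land (pack n f >>> (90 * c)) (2 ^ 90 - 1)) % 39541338091) <<< (90 * (c + 1)) = _
    rw [ih (by omega), pack_last _ fun i _ => runProd_lt_pow hu i, Nat.shiftLeft_eq,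
      pack_shiftRight_lanes (by omega) (fun i hi => hf i (by omega)),
      pack_first (f := fun i => f (c + i)) (by omega) (hf _ (by omega)), pack_succ (c + 1)]
    rfl

theorem scanVec_succ (l Y u : ℕ) : scanVec (l + 1) Y u =
    Nat.add (scanVec l (trunc (Nat.shiftLeft 25 l) Y) u)
      (up (scanVec l (Nat.shiftRight Y (Nat.mul 90 (Nat.shiftLeft 25 l)))
        (Nat.mod (Nat.mul (Nat.shiftRight (scanVec l (trunc (Nat.shiftLeft 25 l) Y) u)
          (Nat.mul 90 (Nat.pred (Nat.shiftLeft 25 l))))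
          (Nat.shiftRight (trunc (Nat.shiftLeft 25 l) Y)
            (Nat.mul 90 (Nat.pred (Nat.shiftLeft 25 l))))) 39541338091))
        (Nat.shiftLeft 25 l)) := by
  have h : scanVec (l + 1) Y u = seqEval (trunc (Nat.shiftLeft 25 l) Y) fun Y₀ =>
      seqEval (scanVec l Y₀ u) fun X =>
      seqEval (Nat.mod (Nat.mul
        (Nat.shiftRight X (Nat.mul 90 (Nat.pred (Nat.shiftLeft 25 l))))
        (Nat.shiftRight Y₀ (Nat.mul 90 (Nat.pred (Nat.shiftLeft 25 l))))) 39541338091) fun u' =>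
      Nat.add X (up (scanVec l (Nat.shiftRight Y (Nat.mul 90 (Nat.shiftLeft 25 l))) u')
        (Nat.shiftLeft 25 l)) := rfl
  rw [h, seqEval_eq, seqEval_eq, seqEval_eq]

theorem scanVec_eq (l : ℕ) (hu : u < 39541338091) (hf : ∀ i < 25 * 2 ^ l, f i < 2 ^ 90) :
    scanVec l (pack (25 * 2 ^ l) f) u = pack (25 * 2 ^ l) (runProd f u) := by
  induction l generalizing u f with
  | zero => exact scanLeaf_eq hu hf 24 (by norm_num)
  | succ l ih =>
    have hn := block_pos l
    have h25 : Nat.shiftLeft 25 l = 25 * 2 ^ l := Nat.shiftLeft_eq _ _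
    have hlast : runProd f u (25 * 2 ^ l - 1) * f (25 * 2 ^ l - 1) % 39541338091 =
        runProd f u (25 * 2 ^ l) := by
      obtain ⟨n, hn'⟩ := Nat.exists_eq_add_of_le' hn
      rw [hn']
      rfl
    rw [scanVec_succ]
    rw [two_mul_block] at hf ⊢
    have hf' : ∀ i < 25 * 2 ^ l, f i < 2 ^ 90 := fun i hi => hf i (by omega)
    rw [h25, trunc_eq, pack_mod (Nat.le_add_left _ _) hf']
    change scanVec l (pack (25 * 2 ^ l) f) u +
      up (scanVec l (pack (25 * 2 ^ l + 25 * 2 ^ l) f >>> (90 * (25 * 2 ^ l)))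
      (Nat.shiftRight (scanVec l (pack (25 * 2 ^ l) f) u) (Nat.mul 90 (Nat.pred (25 * 2 ^ l))) *
        Nat.shiftRight (pack (25 * 2 ^ l) f) (Nat.mul 90 (Nat.pred (25 * 2 ^ l))) %
        39541338091)) (25 * 2 ^ l) = _
    rw [ih hu hf', pack_last' hn fun i _ => runProd_lt_pow hu i, pack_last' hn hf', hlast,
      pack_shiftRight_lanes (Nat.le_add_left _ _) hf', Nat.add_sub_cancel,
      ih (runProd_lt hu _) fun i hi => hf _ (by omega), ← pack_add_up]
    simp only [runProd_add]

theorem lane_pack (hk : k < n) (hf : ∀ i < n, f i < 2 ^ 90) : lane (pack n f) k = f k := by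
  rw [lane, trunc_eq, pack_mod hk fun i hi => hf i (by omega)]
  exact pack_last k fun i hi => hf i (by omega)

theorem oddOnesVec_eq (k : ℕ) : oddOnesVec k = pack (2 * k) (fun i => i % 2) := by
  have h : ∃ s, s * (2 ^ 180 - 1) = 2 ^ (90 * (2 * k)) - 1 ∧
      2 ^ 90 * s = pack (2 * k) (fun i => i % 2) := by
    induction k with
    | zero => exact ⟨0, by simp [pack]⟩
    | succ k ih =>
      obtain ⟨s, hs, hs'⟩ := ih
      refine ⟨s + 2 ^ (90 * (2 * k)), ?_, ?_⟩
      · have := Nat.one_le_two_pow (n := 90 * (2 * k))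
        rw [add_mul, hs, show 90 * (2 * (k + 1)) = 180 + 90 * (2 * k) by ring, pow_add]
        omega
      · rw [mul_add 2, pack_succ, pack_succ, mul_add (2 ^ 90), hs',
          Nat.mul_mod_right, zero_mul, add_zero, show (2 * k + 1) % 2 = 1 by omega, one_mul,
          mul_add 90, pow_add, mul_comm (2 ^ 90)]
  obtain ⟨s, hs, hs'⟩ := h
  change ((up 1 (2 * k) - 1) / (2 ^ 180 - 1)) <<< 90 = _
  rw [up_eq, mul_one, ← hs, Nat.mul_div_cancel _ (by norm_num), Nat.shiftLeft_eq, mul_comm, hs']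

theorem oddOnes_eq : oddOnes = pack blocks (fun i => i % 2) := oddOnesVec_eq 102400

theorem flipOdd_pack (hf : ∀ i < blocks, f i < 39541338091) : flipOdd (pack blocks f) =
    pack blocks (fun i => if i % 2 = 0 then f i else 39541338091 - f i) := by
  have hf' : ∀ i < blocks, f i < 2 ^ 90 := fun i hi => (hf i hi).trans (by norm_num)
  change pack blocks f + oddOnes * 39541338091 -
    2 * (pack blocks f &&& (oddOnes * (2 ^ 90 - 1))) = _
  rw [oddOnes_eq, pack_mul, pack_mul, pack_land le_rfl hf', pack_add, mul_comm 2, pack_mul,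
    pack_sub]
  · refine pack_congr fun i hi => ?_
    have := hf i hi
    rcases Nat.mod_two_eq_zero_or_one i with h | h
    · simp [h]
    · rw [h, one_mul, one_mul, Nat.and_two_pow_sub_one_eq_mod, Nat.mod_eq_of_lt (hf' i hi),
        if_neg one_ne_zero]
      omega
  · intro i hi
    have := hf i hi
    rcases Nat.mod_two_eq_zero_or_one i with h | h
    · simp [h]
    · rw [h, one_mul, one_mul, Nat.and_two_pow_sub_one_eq_mod, Nat.mod_eq_of_lt (hf' i hi)]
      omega
  · intro i hi
    have : i % 2 < 2 := Nat.mod_lt _ (by norm_num)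
    omega

end

section Newton

variable {K : Type*} [Field K]

/-- The falling factorial `y (y - 1) ⋯ (y - i + 1)`. -/
def fall (i : ℕ) (y : K) : K := ∏ j ∈ range i, (y - j)

/-- The product `(x + 1) ⋯ (x + d)`. -/
def blockProd (d : ℕ) (x : K) : K := ∏ i ∈ range d, (x + (i + 1 : ℕ))

/-- The sum of the products `(x + 1) ⋯ (x + j)` over `j < d`. -/
def blockSum (d : ℕ) (x : K) : K := ∑ j ∈ range d, blockProd j x

/-- `f` has the Newton expansion `∑ i ≤ d, c i * y (y - 1) ⋯ (y - i + 1)`. -/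
def IsNewton (d : ℕ) (f : K → K) (c : ℕ → K) : Prop :=
  (∀ i, d < i → c i = 0) ∧ ∀ y, f y = ∑ i ∈ range (d + 1), c i * fall i y

/-- The Cauchy product of two sequences. -/
def cauchyProd (f g : ℕ → K) (n : ℕ) : K := ∑ i ∈ range (n + 1), f i * g (n - i)

theorem fall_succ (i : ℕ) (y : K) : fall (i + 1) y = fall i y * (y - i) := prod_range_succ _ _

theorem blockProd_succ (d : ℕ) (x : K) :
    blockProd (d + 1) x = blockProd d x * (x + (d + 1 : ℕ)) := prod_range_succ _ _

theorem blockSum_succ (d : ℕ) (x : K) : blockSum (d + 1) x = blockSum d x + blockProd d x :=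
  sum_range_succ _ _

theorem blockProd_add (d e : ℕ) (x : K) :
    blockProd (d + e) x = blockProd d x * blockProd e (x + d) := by
  simp only [blockProd, prod_range_add]
  congr 1
  refine prod_congr rfl fun i _ => ?_
  push_cast
  ring

theorem blockSum_add (d e : ℕ) (x : K) :
    blockSum (d + e) x = blockSum d x + blockProd d x * blockSum e (x + d) := by
  simp only [blockSum, sum_range_add, mul_sum, blockProd_add]

theorem IsNewton.mono {d e : ℕ} {f : K → K} {c : ℕ → K} (h : IsNewton d f c) (hde : d ≤ e) :
    IsNewton e f c := by
  refine ⟨fun i hi => h.1 i (by omega), fun y => ?_⟩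
  rw [h.2 y]
  refine sum_subset (range_subset_range.2 (by omega)) fun i _ hi => ?_
  rw [h.1 i (by simpa using hi), zero_mul]

theorem IsNewton.add {d : ℕ} {f g : K → K} {b c : ℕ → K} (hf : IsNewton d f b)
    (hg : IsNewton d g c) : IsNewton d (fun y => f y + g y) (fun i => b i + c i) := by
  refine ⟨fun i hi => by simp only [hf.1 i hi, hg.1 i hi, add_zero], fun y => ?_⟩
  simp only [hf.2 y, hg.2 y, add_mul, sum_add_distrib]

theorem IsNewton.exists_mul_linear {d : ℕ} {f : K → K} {c : ℕ → K} (h : IsNewton d f c)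
    (a b : K) : ∃ c', IsNewton (d + 1) (fun y => f y * (a * y + b)) c' := by
  refine ⟨fun i => (a * i + b) * c i + if i = 0 then 0 else a * c (i - 1), fun i hi => ?_,
    fun y => ?_⟩
  · simp [h.1 i (by omega), h.1 (i - 1) (by omega)]
  · have h1 : ∑ i ∈ range (d + 1 + 1), (a * i + b) * c i * fall i y =
        ∑ i ∈ range (d + 1), (a * i + b) * c i * fall i y := by
      rw [sum_range_succ, h.1 (d + 1) (by omega), mul_zero, zero_mul, add_zero]
    simp only [add_mul _ _ (fall _ y), sum_add_distrib, h1]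
    rw [sum_range_succ' _ (d + 1)]
    simp only [h.2 y, if_true, zero_mul, add_zero, Nat.succ_ne_zero, if_false,
      Nat.add_sub_cancel, fall_succ, sum_mul, ← sum_add_distrib]
    exact sum_congr rfl fun i _ => by ring

theorem exists_isNewton_blockProd (d : ℕ) (a : K) :
    ∃ c, IsNewton d (fun y => blockProd d (y * a)) c := by
  induction d with
  | zero =>
    refine ⟨fun i => if i = 0 then 1 else 0, fun i hi => if_neg (by omega), fun y => ?_⟩
    simp [blockProd, fall]
  | succ d ih =>
    obtain ⟨c, hc⟩ := ih
    obtain ⟨c', hc'⟩ := hc.exists_mul_linear a (d + 1 : ℕ)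
    refine ⟨c', hc'.1, fun y => ?_⟩
    rw [← hc'.2 y]
    beta_reduce
    rw [blockProd_succ, mul_comm a]

theorem exists_isNewton_blockSum (d : ℕ) (a : K) :
    ∃ c, IsNewton d (fun y => blockSum d (y * a)) c := by
  induction d with
  | zero => exact ⟨fun _ => 0, fun _ _ => rfl, fun y => by simp [blockSum]⟩
  | succ d ih =>
    obtain ⟨c, hc⟩ := ih
    obtain ⟨c', hc'⟩ := exists_isNewton_blockProd d a
    obtain h := (hc.add hc').mono (Nat.le_succ d)
    refine ⟨_, h.1, fun y => ?_⟩
    rw [← h.2 y]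
    exact blockSum_succ d _

theorem fall_add (n : ℕ) (y a : K) : fall n (y + a) =
    ∑ ij ∈ antidiagonal n, (n.choose ij.1 : K) * (fall ij.1 y * fall ij.2 a) := by
  induction n with
  | zero => simp [fall]
  | succ n ih =>
    rw [sum_antidiagonal_choose_succ_mul (fun i j => fall i y * fall j a), fall_succ, ih, sum_mul,
      ← sum_add_distrib]
    refine sum_congr rfl fun ij hij => ?_
    have : (n : K) = ij.1 + ij.2 := by rw [← mem_antidiagonal.1 hij, Nat.cast_add]
    rw [fall_succ, fall_succ, Nat.choose_symm_of_eq_add (mem_antidiagonal.1 hij).symm, this]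
    ring

theorem IsNewton.comp_add {d : ℕ} {f : K → K} {c : ℕ → K} (h : IsNewton d f c)
    (hd : ∀ i ≤ d, (i ! : K) ≠ 0) (a : K) :
    IsNewton d (fun y => f (y + a)) fun j => (∑ i ∈ range (d + 1),
      if j ≤ i then c i * i ! * (fall (i - j) a * ((i - j)! : K)⁻¹) else 0) * (j ! : K)⁻¹ := by
  refine ⟨fun j hj => ?_, fun y => ?_⟩
  · refine mul_eq_zero_of_left (sum_eq_zero fun i hi => if_neg ?_) _
    rw [mem_range] at hi
    omega
  · simp only [h.2, fall_add, sum_mul]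
    rw [sum_comm]
    refine sum_congr rfl fun i hi => ?_
    rw [mem_range] at hi
    rw [Nat.sum_antidiagonal_eq_sum_range_succ_mk, mul_sum,
      ← sum_subset (range_subset_range.2 hi)]
    · refine sum_congr rfl fun j hj => ?_
      rw [mem_range] at hj
      have hij : j ≤ i := by omega
      have h1 := hd j (by omega)
      have h2 := hd (i - j) (by omega)
      have h3 : (i ! : K) = i.choose j * j ! * (i - j)! := by
        rw [← Nat.choose_mul_factorial_mul_factorial hij]
        push_cast
        rfl
      rw [if_pos hij, h3]
      field_simp
    · intro j _ hj
      rw [mem_range] at hj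
      rw [if_neg (by omega), zero_mul, zero_mul]

theorem fall_natCast_mul {i k : ℕ} (h : i ≤ k) : fall i (k : K) * (k - i)! = k ! := by
  induction i with
  | zero => simp [fall]
  | succ i ih =>
    rw [← ih (by omega), fall_succ, show k - i = k - (i + 1) + 1 by omega, Nat.factorial_succ,
      mul_assoc]
    congr 1
    rw [Nat.cast_mul, show k - (i + 1) + 1 = k - i by omega, Nat.cast_sub (by omega)]

theorem fall_natCast_of_lt {i k : ℕ} (h : k < i) : fall i (k : K) = 0 :=
  prod_eq_zero (mem_range.2 h) (sub_self _)

theorem IsNewton.cauchyProd_inv_factorial {d k : ℕ} {f : K → K} {c : ℕ → K} (h : IsNewton d f c)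
    (hk : ∀ i ≤ k, (i ! : K) ≠ 0) :
    cauchyProd c (fun i => (i ! : K)⁻¹) k = f k * (k ! : K)⁻¹ := by
  have h' := (h.mono (le_max_left d k)).2 k
  rw [h', cauchyProd, sum_mul,
    ← sum_subset (range_subset_range.2 (Nat.succ_le_succ (le_max_right d k)))]
  · refine sum_congr rfl fun i hi => ?_
    have hi' : i ≤ k := Nat.lt_succ_iff.1 (mem_range.1 hi)
    have h1 := hk k le_rfl
    have h2 := hk (k - i) (by omega)
    have h3 := fall_natCast_mul (K := K) hi'
    field_simp
    linear_combination (-c i) * h3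
  · intro i _ hi
    rw [mem_range] at hi
    rw [fall_natCast_of_lt (by omega), mul_zero, zero_mul]

theorem cauchyProd_eq_coeff (f g : ℕ → K) (n : ℕ) :
    cauchyProd f g n = PowerSeries.coeff n (PowerSeries.mk f * PowerSeries.mk g) := by
  rw [PowerSeries.coeff_mul, Nat.sum_antidiagonal_eq_sum_range_succ_mk]
  simp [cauchyProd]

theorem cauchyProd_congr {f f' g g' : ℕ → K} {n : ℕ} (hf : ∀ i ≤ n, f i = f' i)
    (hg : ∀ i ≤ n, g i = g' i) : cauchyProd f g n = cauchyProd f' g' n :=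
  sum_congr rfl fun i hi => by
    rw [hf i (Nat.lt_succ_iff.1 (mem_range.1 hi)), hg _ (Nat.sub_le _ _)]

theorem cauchyProd_inv_factorial_alternating {n : ℕ} (hn : ∀ i ≤ n, (i ! : K) ≠ 0) :
    cauchyProd (fun i => (i ! : K)⁻¹) (fun i => (-1) ^ i * (i ! : K)⁻¹) n =
      if n = 0 then 1 else 0 := by
  have h : cauchyProd (fun i => (i ! : K)⁻¹) (fun i => (-1) ^ i * (i ! : K)⁻¹) n * n ! =
      (1 + -1) ^ n := by
    rw [add_pow, cauchyProd, sum_mul]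
    refine sum_congr rfl fun i hi => ?_
    have hi' : i ≤ n := Nat.lt_succ_iff.1 (mem_range.1 hi)
    have h1 := hn i hi'
    have h2 := hn (n - i) (by omega)
    rw [← Nat.choose_mul_factorial_mul_factorial hi']
    push_cast
    field_simp
    ring
  rw [add_neg_cancel, zero_pow_eq] at h
  split_ifs at h ⊢ with h0
  · subst h0
    simpa using h
  · exact (mul_eq_zero.1 h).resolve_right (hn n le_rfl)

theorem IsNewton.cauchyProd_alternating {d j : ℕ} {f : K → K} {c : ℕ → K} (h : IsNewton d f c)
    (hj : ∀ i ≤ j, (i ! : K) ≠ 0) :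
    cauchyProd (fun k => f k * (k ! : K)⁻¹) (fun i => (-1) ^ i * (i ! : K)⁻¹) j = c j := by
  rw [cauchyProd_congr (fun i hi => (h.cauchyProd_inv_factorial fun k hk =>
    hj k (hk.trans hi)).symm) fun _ _ => rfl, cauchyProd_eq_coeff]
  have h1 : PowerSeries.mk (cauchyProd c fun i => (i ! : K)⁻¹) =
      PowerSeries.mk c * PowerSeries.mk fun i => (i ! : K)⁻¹ := by
    ext n
    rw [PowerSeries.coeff_mk, cauchyProd_eq_coeff]
  have h2 : PowerSeries.coeff j (PowerSeries.mk c *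
      ((PowerSeries.mk fun i => (i ! : K)⁻¹) * PowerSeries.mk fun i => (-1) ^ i * (i ! : K)⁻¹)) =
      ∑ ik ∈ antidiagonal j, c ik.1 * if ik.2 = 0 then 1 else 0 := by
    rw [PowerSeries.coeff_mul]
    refine sum_congr rfl fun ik hik => ?_
    have := mem_antidiagonal.1 hik
    rw [PowerSeries.coeff_mk, ← cauchyProd_eq_coeff,
      cauchyProd_inv_factorial_alternating fun i hi => hj i (by omega)]
  rw [h1, mul_assoc, h2, Nat.sum_antidiagonal_eq_sum_range_succ_mk, sum_range_succ,
    sum_eq_zero]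
  · simp
  · intro i hi
    rw [mem_range] at hi
    rw [if_neg (by omega), mul_zero]

theorem factorial_mul_blockProd (n d : ℕ) : (n ! : K) * blockProd d (n : K) = ((n + d)! : ℕ) := by
  induction d with
  | zero => simp [blockProd]
  | succ d ih =>
    rw [blockProd_succ, ← mul_assoc, ih, ← add_assoc, Nat.factorial_succ]
    push_cast
    ring

theorem prod_blockProd (D k : ℕ) :
    ∏ j ∈ range k, blockProd D ((j : K) * D) = ((k * D)! : ℕ) := by
  induction k with
  | zero => simp
  | succ k ih =>
    rw [prod_range_succ, ih, ← Nat.cast_mul k D, factorial_mul_blockProd, add_one_mul]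

theorem sum_factorial_mul_blockSum (D n : ℕ) :
    ∑ k ∈ range n, ((k * D)! : K) * blockSum D ((k : K) * D) = ∑ i ∈ range (n * D), (i ! : K) := by
  induction n with
  | zero => simp
  | succ n ih =>
    rw [sum_range_succ, ih, add_one_mul, sum_range_add, blockSum, mul_sum]
    congr 1
    refine sum_congr rfl fun j _ => ?_
    rw [← Nat.cast_mul n D, factorial_mul_blockProd]

end Newton

/-- The first `n` lanes of the product of `x` and `y` read as polynomials in `2 ^ 90`, with
`39541338091` cast out. -/
def conv (n x y : ℕ) : ℕ := reduce (trunc n (Nat.mul x (trunc n y)))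

/-- The correlation of `c * fact` with the reversed table `R`. -/
def corr (R fact c : ℕ) : ℕ := reduce (Nat.mul (reduce (laneMul c fact)) R)

/-- The vector of `blocks` lanes equal to `2 ^ 45 - 1`. -/
def lowHalf : ℕ := Nat.mul ones (2 ^ 45 - 1)

theorem land_lowHalf {n : ℕ} {p q : ℕ → ℕ} (hn : n ≤ blocks) (hp : ∀ i < n, p i < 2 ^ 45)
    (hq : ∀ i < n, q i < 2 ^ 45) :
    Nat.land (pack n fun i => p i + q i * 2 ^ 45) lowHalf = pack n p := by
  have h : ∀ i < n, p i + q i * 2 ^ 45 < 2 ^ 90 := fun i hi => by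
    have := hp i hi
    have := hq i hi
    omega
  refine (pack_land_ones_mul hn h (Nat.sub_lt_of_lt (by norm_num))).trans
    (pack_congr fun i hi => ?_)
  rw [Nat.and_two_pow_sub_one_eq_mod, Nat.add_mul_mod_self_right, Nat.mod_eq_of_lt (hp i hi)]

theorem land_shiftRight_lowHalf {n : ℕ} {p q : ℕ → ℕ} (hn : n ≤ blocks)
    (hp : ∀ i < n, p i < 2 ^ 45) (hq : ∀ i < n, q i < 2 ^ 45) :
    Nat.land (Nat.shiftRight (pack n fun i => p i + q i * 2 ^ 45) 45) lowHalf = pack n q := by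
  rcases n with - | n
  · exact (congr_arg (Nat.land · lowHalf) (Nat.zero_shiftRight 45)).trans (Nat.zero_and _)
  · have h1 : Nat.shiftRight (pack (n + 1) fun i => p i + q i * 2 ^ 45) 45 =
        pack (n + 1) fun i => q i + (if i < n then p (i + 1) else 0) * 2 ^ 45 := by
      change _ >>> 45 = _
      rw [Nat.shiftRight_eq_div_pow, ← pack_add, ← pack_mul, ← pack_add, ← pack_mul,
        pack_succ' n p, ← pack_zero_extend (Nat.le_succ n) fun i hi => if_neg (by omega),
        pack_congr fun i hi => if_pos hi]
      have := hp 0 n.succ_pos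
      omega
    rw [h1, land_lowHalf hn hq]
    intro i hi
    split_ifs
    · exact hp _ (by omega)
    · norm_num

section

variable {K : Type*} [Field K] {b n m k : ℕ} {X Y : ℕ} {f g : ℕ → K}

/-- The `n` lanes of `X` are below `b` and represent `f`. -/
def Rep (b n X : ℕ) (f : ℕ → K) : Prop :=
  ∃ v, X = pack n v ∧ ∀ i < n, v i < b ∧ (v i : K) = f i

theorem Rep.congr (h : Rep b n X f) (hfg : ∀ i < n, f i = g i) : Rep b n X g := by
  obtain ⟨v, rfl, hv⟩ := h
  exact ⟨v, rfl, fun i hi => ⟨(hv i hi).1, (hv i hi).2.trans (hfg i hi)⟩⟩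

theorem Rep.mono {c : ℕ} (h : Rep b n X f) (hbc : b ≤ c) : Rep c n X f := by
  obtain ⟨v, rfl, hv⟩ := h
  exact ⟨v, rfl, fun i hi => ⟨(hv i hi).1.trans_le hbc, (hv i hi).2⟩⟩

theorem Rep.add {c : ℕ} (hX : Rep b n X f) (hY : Rep c n Y g) :
    Rep (b + c) n (Nat.add X Y) fun i => f i + g i := by
  obtain ⟨v, rfl, hv⟩ := hX
  obtain ⟨w, rfl, hw⟩ := hY
  refine ⟨_, pack_add, fun i hi => ⟨Nat.add_lt_add (hv i hi).1 (hw i hi).1, ?_⟩⟩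
  rw [Nat.cast_add, (hv i hi).2, (hw i hi).2]

theorem Rep.laneMul (hX : Rep (2 ^ 36) n X f) (hY : Rep (2 ^ 36) m Y g) (hn : n ≤ m)
    (hm : m ≤ blocks) : Rep (2 ^ 72) n (laneMul X Y) fun i => f i * g i := by
  obtain ⟨v, rfl, hv⟩ := hX
  obtain ⟨w, rfl, hw⟩ := hY
  refine ⟨_, laneMul_pack hn hm (fun i hi => (hv i hi).1) fun i hi => (hw i hi).1,
    fun i hi => ⟨?_, ?_⟩⟩
  · have h1 := (hv i hi).1
    have h2 := (hw i (by omega)).1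
    calc v i * w i < 2 ^ 36 * 2 ^ 36 := Nat.mul_lt_mul'' h1 h2
      _ = 2 ^ 72 := by norm_num
  · rw [Nat.cast_mul, (hv i hi).2, (hw i (by omega)).2]

theorem Rep.trunc (h : Rep b m X f) (hb : b ≤ 2 ^ 90) (hn : n ≤ m) : Rep b n (trunc n X) f := by
  obtain ⟨v, rfl, hv⟩ := h
  exact ⟨v, (trunc_eq _ _).trans (pack_mod hn fun i hi => (hv i (by omega)).1.trans_le hb),
    fun i hi => hv i (by omega)⟩

theorem Rep.mul (hX : Rep (2 ^ 36) k X f) (hf : ∀ i, k ≤ i → f i = 0)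
    (hY : Rep (2 ^ 36) n Y g) (hg : ∀ i, n ≤ i → g i = 0) (hk : k ≤ 2 ^ 17) :
    Rep (2 ^ 90) (k + n) (Nat.mul X Y) (cauchyProd f g) := by
  obtain ⟨v, rfl, hv⟩ := hX
  obtain ⟨w, rfl, hw⟩ := hY
  have hv' : pack k v = pack k fun i => if i < k then v i else 0 :=
    pack_congr fun i hi => (if_pos hi).symm
  have hw' : pack n w = pack n fun i => if i < n then w i else 0 :=
    pack_congr fun i hi => (if_pos hi).symm
  have hmul : Nat.mul (pack k v) (pack n w) = pack (k + n) fun j => ∑ i ∈ range (j + 1),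
      (if i < k then v i else 0) * (if j - i < n then w (j - i) else 0) := by
    rw [hv', hw']
    exact pack_mul_pack (fun i hi => if_neg (by omega)) fun i hi => if_neg (by omega)
  refine ⟨_, hmul, fun j _ => ⟨?_, ?_⟩⟩
  · calc ∑ i ∈ range (j + 1), (if i < k then v i else 0) * (if j - i < n then w (j - i) else 0)
        ≤ ∑ i ∈ range (j + 1), if i ∈ range k then 2 ^ 72 else 0 := by
          refine sum_le_sum fun i _ => ?_
          simp only [mem_range]
          split_ifs with h1 h2
          · calc v i * w (j - i) ≤ 2 ^ 36 * 2 ^ 36 :=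
                Nat.mul_le_mul (hv _ h1).1.le (hw _ h2).1.le
              _ = 2 ^ 72 := by norm_num
          all_goals simp
      _ = #(range (j + 1) ∩ range k) * 2 ^ 72 := by
          rw [sum_ite_mem, sum_const, smul_eq_mul]
      _ ≤ 2 ^ 17 * 2 ^ 72 := by
          refine Nat.mul_le_mul_right _ ((card_le_card inter_subset_right).trans ?_)
          rwa [card_range]
      _ < 2 ^ 90 := by norm_num
  · rw [Nat.cast_sum]
    refine sum_congr rfl fun i _ => ?_
    rw [Nat.cast_mul]
    congr 1
    · split_ifs with h
      · exact (hv _ h).2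
      · rw [Nat.cast_zero, hf _ (by omega)]
    · split_ifs with h
      · exact (hw _ h).2
      · rw [Nat.cast_zero, hg _ (by omega)]

variable [CharP K 39541338091]

theorem Rep.reduce (h : Rep (2 ^ 90) n X f) (hn : n ≤ blocks) : Rep (2 ^ 36) n (reduce X) f := by
  obtain ⟨v, rfl, hv⟩ := h
  obtain ⟨w, hw, hw'⟩ := exists_reduce_pack hn fun i hi => (hv i hi).1
  exact ⟨w, hw, fun i hi => ⟨(hw' i hi).1,
    ((CharP.natCast_eq_natCast K 39541338091).2 (hw' i hi).2).trans (hv i hi).2⟩⟩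

theorem Rep.reduce_laneMul (hX : Rep (2 ^ 36) n X f) (hY : Rep (2 ^ 36) m Y g) (hn : n ≤ m)
    (hm : m ≤ blocks) : Rep (2 ^ 36) n (LeftFactorial.reduce (LeftFactorial.laneMul X Y))
      fun i => f i * g i :=
  ((hX.laneMul hY hn hm).mono (by norm_num)).reduce (hn.trans hm)

end

theorem pow_div_ne_one {p n q e c : ℕ} {a : ZMod p} (he : n / q = e) (h : a ^ e = c)
    (hc : c % p ≠ 1 % p) : a ^ (n / q) ≠ 1 := by
  rwa [he, h, ← Nat.cast_one, Ne, ZMod.natCast_eq_natCast_iff']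

theorem prime_of_pow {n p : ℕ} {a : ZMod p} (hn : p - 1 = n) (h : a ^ n = 1)
    (h' : ∀ q : ℕ, q.Prime → q ∣ n → a ^ (n / q) ≠ 1) : p.Prime := by
  subst hn
  exact lucas_primality p a h h'

theorem prime_439348201 : Nat.Prime 439348201 := by
  refine prime_of_pow (n := 439348200) (a := 7) (by norm_num) (by reduce_mod_char)
    fun q hq h => ?_
  have hq' : q = 2 ∨ q = 3 ∨ q = 5 ∨ q = 43 ∨ q = 17029 := by
    have h2 : q ∣ 2 ^ 3 → q = 2 := fun h =>
      (Nat.prime_dvd_prime_iff_eq hq Nat.prime_two).1 (hq.dvd_of_dvd_pow h)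
    have h5 : q ∣ 5 ^ 2 → q = 5 := fun h =>
      (Nat.prime_dvd_prime_iff_eq hq Nat.prime_five).1 (hq.dvd_of_dvd_pow h)
    rw [show 439348200 = 2 ^ 3 * (3 * (5 ^ 2 * (43 * 17029))) by norm_num, hq.dvd_mul, hq.dvd_mul,
      hq.dvd_mul, hq.dvd_mul, Nat.prime_dvd_prime_iff_eq hq Nat.prime_three,
      Nat.prime_dvd_prime_iff_eq hq (by norm_num : Nat.Prime 43),
      Nat.prime_dvd_prime_iff_eq hq (by norm_num : Nat.Prime 17029)] at h
    exact h.imp h2 (Or.imp_right (Or.imp_left h5))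
  rcases hq' with rfl | rfl | rfl | rfl | rfl
  · exact pow_div_ne_one (e := 219674100) (c := 439348200) (by norm_num)
      (by rw [Nat.cast_ofNat]; reduce_mod_char) (by norm_num)
  · exact pow_div_ne_one (e := 146449400) (c := 146977776) (by norm_num)
      (by rw [Nat.cast_ofNat]; reduce_mod_char) (by norm_num)
  · exact pow_div_ne_one (e := 87869640) (c := 38183581) (by norm_num)
      (by rw [Nat.cast_ofNat]; reduce_mod_char) (by norm_num)
  · exact pow_div_ne_one (e := 10217400) (c := 208977064) (by norm_num)
      (by rw [Nat.cast_ofNat]; reduce_mod_char) (by norm_num)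
  · exact pow_div_ne_one (e := 25800) (c := 148351848) (by norm_num)
      (by rw [Nat.cast_ofNat]; reduce_mod_char) (by norm_num)

theorem prime_39541338091 : Nat.Prime 39541338091 := by
  refine prime_of_pow (n := 39541338090) (a := 2) (by norm_num) (by reduce_mod_char)
    fun q hq h => ?_
  have hq' : q = 2 ∨ q = 3 ∨ q = 5 ∨ q = 439348201 := by
    have h3 : q ∣ 3 ^ 2 → q = 3 := fun h =>
      (Nat.prime_dvd_prime_iff_eq hq Nat.prime_three).1 (hq.dvd_of_dvd_pow h)
    rw [show 39541338090 = 2 * (3 ^ 2 * (5 * 439348201)) by norm_num, hq.dvd_mul, hq.dvd_mul,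
      hq.dvd_mul, Nat.prime_dvd_prime_iff_eq hq Nat.prime_two,
      Nat.prime_dvd_prime_iff_eq hq Nat.prime_five,
      Nat.prime_dvd_prime_iff_eq hq prime_439348201] at h
    exact Or.imp_right (Or.imp_left h3) h
  rcases hq' with rfl | rfl | rfl | rfl
  · exact pow_div_ne_one (e := 19770669045) (c := 39541338090) (by norm_num)
      (by rw [Nat.cast_ofNat]; reduce_mod_char) (by norm_num)
  · exact pow_div_ne_one (e := 13180446030) (c := 8856442799) (by norm_num)
      (by rw [Nat.cast_ofNat]; reduce_mod_char) (by norm_num)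
  · exact pow_div_ne_one (e := 7908267618) (c := 20177127295) (by norm_num)
      (by rw [Nat.cast_ofNat]; reduce_mod_char) (by norm_num)
  · exact pow_div_ne_one (e := 90) (c := 16133763057) (by norm_num)
      (by rw [Nat.cast_ofNat]; reduce_mod_char) (by norm_num)

section

variable {K : Type*} [Field K] {b n m k L : ℕ} {X Y P Q : ℕ} {f g : ℕ → K}

theorem Rep.halves (hP : Rep (2 ^ 36) n P f) (hQ : Rep (2 ^ 36) n Q g) (hm : m ≤ n)
    (hn : n ≤ blocks)
    (hY : Y = Nat.shiftRight (Nat.add P (Nat.shiftLeft Q 45)) (Nat.mul 90 m)) :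
    Rep (2 ^ 36) (n - m) (Nat.land Y lowHalf) (fun i => f (m + i)) ∧
      Rep (2 ^ 36) (n - m) (Nat.land (Nat.shiftRight Y 45) lowHalf) (fun i => g (m + i)) := by
  obtain ⟨v, rfl, hv⟩ := hP
  obtain ⟨w, rfl, hw⟩ := hQ
  have h : Y = pack (n - m) fun i => v (m + i) + w (m + i) * 2 ^ 45 := by
    rw [hY]
    change (pack n v + (pack n w) <<< 45) >>> (90 * m) = _
    rw [pack_shiftLeft, pack_add, pack_shiftRight_lanes hm]
    intro i hi
    have := (hv i (by omega)).1
    have := (hw i (by omega)).1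
    omega
  have hv' : ∀ i < n - m, v (m + i) < 2 ^ 45 := fun i hi =>
    (hv (m + i) (by omega)).1.trans (by norm_num)
  have hw' : ∀ i < n - m, w (m + i) < 2 ^ 45 := fun i hi =>
    (hw (m + i) (by omega)).1.trans (by norm_num)
  rw [h]
  exact ⟨⟨_, land_lowHalf (by omega) hv' hw', fun i hi => hv _ (by omega)⟩,
    ⟨_, land_shiftRight_lowHalf (by omega) hv' hw', fun i hi => hw _ (by omega)⟩⟩

theorem cauchyProd_reverse {d j : ℕ} (c s : ℕ → K) (hd : d < L) :
    cauchyProd (fun i => if i < d + 1 then c i else 0)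
      (fun i => if i < L then s (L - 1 - i) else 0) (L - 1 + j) =
      ∑ i ∈ range (d + 1), if j ≤ i then c i * s (i - j) else 0 := by
  rw [cauchyProd, ← sum_subset (range_subset_range.2 (by omega : d + 1 ≤ L - 1 + j + 1))]
  · refine sum_congr rfl fun i hi => ?_
    have hi' := mem_range.1 hi
    rw [if_pos hi']
    split_ifs with h1 h2 h2
    · congr 2
      omega
    · omega
    · omega
    · rw [mul_zero]
  · intro i _ hi
    rw [if_neg (by simpa using hi), zero_mul]

variable [CharP K 39541338091]

theorem Rep.conv (hX : Rep (2 ^ 36) k X f) (hf : ∀ i < n, k ≤ i → f i = 0)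
    (hY : Rep (2 ^ 36) m Y g) (hk : k ≤ 2 ^ 17) (hnm : n ≤ m) (hn : n ≤ blocks) :
    Rep (2 ^ 36) n (conv n X Y) (cauchyProd f g) := by
  have hX' : Rep (2 ^ 36) k X fun i => if i < k then f i else 0 :=
    hX.congr fun i hi => (if_pos hi).symm
  have hY' : Rep (2 ^ 36) n (LeftFactorial.trunc n Y) fun i => if i < n then g i else 0 :=
    (hY.trunc (by norm_num) hnm).congr fun i hi => (if_pos hi).symm
  have h := hX'.mul (fun i hi => if_neg (by omega)) hY' (fun i hi => if_neg (by omega)) hk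
  refine ((h.trunc le_rfl (Nat.le_add_left n k)).reduce hn).congr fun i hi => ?_
  refine cauchyProd_congr (fun j hj => ?_) fun j hj => if_pos (by omega)
  split_ifs with h
  · rfl
  · rw [hf j (by omega) (by omega)]

theorem Rep.corr {R fact : ℕ} {r : ℕ → K} (hX : Rep (2 ^ 36) k X f)
    (hfact : Rep (2 ^ 36) blocks fact fun i => (i ! : K)) (hR : Rep (2 ^ 36) L R r)
    (hk : k ≤ 2 ^ 17) (hkL : k + L ≤ blocks) :
    Rep (2 ^ 36) (k + L) (corr R fact X) (cauchyProd (fun i => if i < k then f i * i ! else 0)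
      fun i => if i < L then r i else 0) := by
  have hX' : Rep (2 ^ 36) k (LeftFactorial.reduce (LeftFactorial.laneMul X fact))
      fun i => if i < k then f i * i ! else 0 :=
    (hX.reduce_laneMul hfact (by omega) le_rfl).congr fun i hi => (if_pos hi).symm
  have hR' : Rep (2 ^ 36) L R fun i => if i < L then r i else 0 :=
    hR.congr fun i hi => (if_pos hi).symm
  exact (hX'.mul (fun i hi => if_neg (by omega)) hR' (fun i hi => if_neg (by omega)) hk).reduce hkL

theorem natCast_runProd (h : ℕ → ℕ) (u i : ℕ) :
    (runProd h u i : K) = u * ∏ j ∈ range i, (h j : K) := by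
  induction i with
  | zero => simp [runProd]
  | succ i ih =>
    rw [runProd, ← CharP.cast_eq_mod, Nat.cast_mul, ih, prod_range_succ, mul_assoc]

theorem rep_runProd (h : ℕ → ℕ) {u : ℕ} (hu : u < 39541338091) (n : ℕ) :
    Rep (2 ^ 36) n (pack n (runProd h u)) fun i => (u * ∏ j ∈ range i, (h j : K) : K) :=
  ⟨_, rfl, fun i _ => ⟨(runProd_lt hu i).trans (by norm_num), natCast_runProd h u i⟩⟩

theorem natCast_factorial_ne_zero (hn : n < 39541338091) : (n ! : K) ≠ 0 := by
  rw [Ne, CharP.cast_eq_zero_iff K 39541338091, prime_39541338091.dvd_factorial]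
  omega

end

/-- For `L = 25 * 2 ^ e`, the vector with lanes `C(a, L - 1 - t)`, where `nega` represents `-a`. -/
def chooseRevVec (e nega nfact : ℕ) : ℕ :=
  reduce (laneMul (risingVec e (Nat.sub 39541338092 (Nat.shiftLeft 25 e))
    (lane nfact (Nat.pred (Nat.shiftLeft 25 e)))) (risingRevVec e nega 1))

/-- Passes to `k` the first `n` values at multiples of `D` of the product and the sum of length
`2 * d`, divided by factorials, given the Newton coefficients of those of length `d`. -/
def double (fact ifact nfact n e nega cP cQ : ℕ) (k : ℕ → ℕ → ℕ) : ℕ :=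
  seqEval (chooseRevVec e nega nfact) fun R =>
  seqEval (Nat.shiftRight (Nat.add (corr R fact cP) (Nat.shiftLeft (corr R fact cQ) 45))
    (Nat.mul 90 (Nat.pred (Nat.shiftLeft 25 e)))) fun Y =>
  seqEval (reduce (laneMul (Nat.land Y lowHalf) ifact)) fun cP' =>
  seqEval (reduce (laneMul (Nat.land (Nat.shiftRight Y 45) lowHalf) ifact)) fun cQ' =>
  seqEval (reduce (laneMul (conv n cP ifact) fact)) fun u =>
  seqEval (reduce (laneMul (conv n cP' ifact) u)) fun hP =>
  seqEval (reduce (Nat.add (conv n cQ ifact) (laneMul (conv n cQ' ifact) u))) fun hQ =>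
  k hP hQ

section

variable {K : Type*} [Field K] [CharP K 39541338091] {n d e nega fact ifact nfact cP cQ : ℕ}
  {a D : K} {p q : ℕ → K}

theorem rep_factorial : Rep (2 ^ 36) blocks (risingVec 13 1 1) fun i => (i ! : K) := by
  rw [risingVec_eq 13 (by norm_num)]
  refine (rep_runProd _ (by norm_num) _).congr fun i _ => ?_
  rw [Nat.cast_one, one_mul, ← prod_range_add_one_eq_factorial, Nat.cast_prod]
  exact prod_congr rfl fun j _ => by rw [add_comm]

theorem sign_mul_factorial_mul_runProd {N : ℕ} {u : ℕ} (hN : N ≤ 39541338091) {t : ℕ}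
    (ht : t < N) (h0 : runProd (fun i => 39541338091 - N + 1 + i) u (N - 1) = 1) :
    (-1) ^ t * (t ! : K) *
      (runProd (fun i => 39541338091 - N + 1 + i) u (N - 1 - t) : ℕ) = 1 := by
  induction t with
  | zero => simp [h0]
  | succ t ih =>
    have h : N - 1 - t = N - 1 - (t + 1) + 1 := by omega
    have h' : ((39541338091 - N + 1 + (N - 1 - (t + 1)) : ℕ) : K) = -(t + 1 : ℕ) := by
      rw [eq_neg_iff_add_eq_zero, ← Nat.cast_add,
        show 39541338091 - N + 1 + (N - 1 - (t + 1)) + (t + 1) = 39541338091 by omega]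
      exact CharP.cast_eq_zero K _
    refine Eq.trans ?_ (ih (by omega))
    rw [h, runProd, ← CharP.cast_eq_mod, Nat.cast_mul, h', Nat.factorial_succ,
      pow_succ]
    push_cast
    ring

theorem rep_sign_inv_factorial {u : ℕ} (hu : u < 39541338091)
    (h : Nat.land (risingRevVec 13 39541133292 u) (2 ^ 90 - 1) = 1) :
    Rep 39541338091 blocks (risingRevVec 13 39541133292 u) fun t => (-1) ^ t * (t ! : K)⁻¹ := by
  have hb : 25 * 2 ^ 13 = blocks := rfl
  have hb' : 39541133292 = 39541338091 - blocks + 1 := rfl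
  rw [risingRevVec_eq 13 hu] at h
  have h0 := (pack_first (f := fun t => runProd (fun i => 39541133292 + i) u (25 * 2 ^ 13 - 1 - t))
    (block_pos 13) (runProd_lt_pow hu _)).symm.trans h
  rw [hb, hb', Nat.sub_zero] at h0
  rw [risingRevVec_eq 13 hu, hb, hb']
  refine ⟨_, rfl, fun t ht => ⟨runProd_lt hu _, ?_⟩⟩
  have hbl : blocks ≤ 39541338091 := by norm_num [blocks]
  have h1 := sign_mul_factorial_mul_runProd (K := K) hbl ht h0
  have h2 : (t ! : K) ≠ 0 := natCast_factorial_ne_zero (ht.trans_le hbl)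
  have h3 : ((-1) ^ t * (-1) ^ t : K) = 1 := by rw [← mul_pow, neg_one_mul, neg_neg, one_pow]
  field_simp
  linear_combination (-1) ^ t * h1 - t ! *
    (runProd (fun i => 39541338091 - blocks + 1 + i) u (blocks - 1 - t) : K) * h3

omit [CharP K 39541338091] in
theorem fall_neg (i : ℕ) (a : K) : ∏ j ∈ range i, (-a + j) = (-1) ^ i * fall i a := by
  rw [fall, ← card_range i, ← prod_const, card_range, ← prod_mul_distrib]
  exact prod_congr rfl fun j _ => by ring

theorem sign_inv_factorial_mul_prod {N t : ℕ} (hN : N < 39541338091) (ht : t ≤ N) :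
    (-1) ^ N * (N ! : K)⁻¹ * ∏ j ∈ range t, ((39541338091 - N + j : ℕ) : K) =
      (-1) ^ (N - t) * ((N - t)! : K)⁻¹ := by
  induction t with
  | zero => simp
  | succ t ih =>
    have h : N - t = N - (t + 1) + 1 := by omega
    have h1 : ((39541338091 - N + t : ℕ) : K) = -(N - (t + 1) + 1 : ℕ) := by
      rw [eq_neg_iff_add_eq_zero, ← Nat.cast_add,
        show 39541338091 - N + t + (N - (t + 1) + 1) = 39541338091 by omega]
      exact CharP.cast_eq_zero K _
    have h2 : ((N - (t + 1) + 1)! : K) ≠ 0 := natCast_factorial_ne_zero (by omega)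
    rw [prod_range_succ, ← mul_assoc, ih (by omega), h, h1, pow_succ]
    rw [Nat.factorial_succ, Nat.cast_mul] at h2 ⊢
    have h3 := left_ne_zero_of_mul h2
    have h4 := right_ne_zero_of_mul h2
    field_simp

theorem rep_chooseRevVec (he : 25 * 2 ^ e ≤ blocks) (ha : (nega : K) = -a)
    (hn : Rep 39541338091 blocks nfact fun t => (-1) ^ t * (t ! : K)⁻¹) :
    Rep (2 ^ 36) (25 * 2 ^ e) (chooseRevVec e nega nfact) fun t =>
      fall (25 * 2 ^ e - 1 - t) a * ((25 * 2 ^ e - 1 - t)! : K)⁻¹ := by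
  obtain ⟨v, hnv, hv⟩ := hn
  have hpos := block_pos e
  have hbl : blocks < 39541338091 := by norm_num [blocks]
  have hL : Nat.shiftLeft 25 e = 25 * 2 ^ e := Nat.shiftLeft_eq _ _
  rw [chooseRevVec, hL, hnv]
  generalize hLe : 25 * 2 ^ e = L at *
  have h1 : Nat.sub 39541338092 L = 39541338091 - (L - 1) := by
    rw [Nat.sub_eq]
    omega
  have h2 : L - 1 < blocks := by omega
  rw [h1, Nat.pred_eq_sub_one, lane_pack h2 fun i hi => (hv i hi).1.trans (by norm_num),
    risingVec_eq e (hv _ h2).1, risingRevVec_eq e (by norm_num), hLe]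
  have h3 := rep_runProd (K := K) (fun i => 39541338091 - (L - 1) + i) (hv _ h2).1 L
  have h4 : Rep (2 ^ 36) L (pack L fun t => runProd (fun i => nega + i) 1 (L - 1 - t))
      fun t => (-1) ^ (L - 1 - t) * fall (L - 1 - t) a := by
    refine ⟨_, rfl, fun t _ => ⟨(runProd_lt (by norm_num) _).trans (by norm_num), ?_⟩⟩
    rw [natCast_runProd, Nat.cast_one, one_mul]
    beta_reduce
    rw [← fall_neg, ← ha]
    exact prod_congr rfl fun j _ => Nat.cast_add _ _
  refine (h3.reduce_laneMul h4 le_rfl he).congr fun t ht => ?_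
  have h5 : ((v (L - 1) : ℕ) : K) = (-1) ^ (L - 1) * ((L - 1)! : K)⁻¹ := (hv _ h2).2
  have h6 : ((-1) ^ (L - 1 - t) * (-1) ^ (L - 1 - t) : K) = 1 := by
    rw [← mul_pow, neg_one_mul, neg_neg, one_pow]
  rw [h5, sign_inv_factorial_mul_prod (by omega) (by omega)]
  linear_combination (fall (L - 1 - t) a * ((L - 1 - t)! : K)⁻¹) * h6

theorem double_eq (k : ℕ → ℕ → ℕ) : ∃ R Y u,
    R = chooseRevVec e nega nfact ∧
    Y = Nat.shiftRight (Nat.add (corr R fact cP) (Nat.shiftLeft (corr R fact cQ) 45))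
      (Nat.mul 90 (Nat.pred (Nat.shiftLeft 25 e))) ∧
    u = reduce (laneMul (conv n cP ifact) fact) ∧
    double fact ifact nfact n e nega cP cQ k =
      k (reduce (laneMul (conv n (reduce (laneMul (Nat.land Y lowHalf) ifact)) ifact) u))
        (reduce (Nat.add (conv n cQ ifact) (laneMul
          (conv n (reduce (laneMul (Nat.land (Nat.shiftRight Y 45) lowHalf) ifact)) ifact) u))) := by
  refine ⟨_, _, _, rfl, rfl, rfl, ?_⟩
  simp only [double, seqEval_eq]

theorem Rep.shift {X : ℕ} {cf : ℕ → K} {F : K → K} {L : ℕ} (hL : d < L)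
    (hc : IsNewton d F cf) (hX : Rep (2 ^ 36) (d + 2) X fun j =>
      cauchyProd (fun i => if i < d + 1 then cf i * i ! else 0)
        (fun i => if i < L then fall (L - 1 - i) a * ((L - 1 - i)! : K)⁻¹ else 0) (L - 1 + j))
    (hifact : Rep (2 ^ 36) blocks ifact fun i => (i ! : K)⁻¹) (hd : d + 2 ≤ 2 ^ 17)
    (hn : n ≤ blocks) :
    Rep (2 ^ 36) n (LeftFactorial.conv n (LeftFactorial.reduce (LeftFactorial.laneMul X ifact)) ifact)
      fun j => F (j + a) * (j ! : K)⁻¹ := by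
  have hbl : blocks < 39541338091 := by norm_num [blocks]
  have hbl' : 2 ^ 17 ≤ blocks := by norm_num [blocks]
  have h := hc.comp_add (fun i hi => natCast_factorial_ne_zero (by omega)) a
  have h1 := (hX.reduce_laneMul hifact (by omega) le_rfl).congr fun j _ =>
    congr_arg (· * (j ! : K)⁻¹)
      (cauchyProd_reverse (fun i => cf i * i !) (fun i => fall i a * (i ! : K)⁻¹) hL)
  refine (h1.conv (fun i _ hi => h.1 i (by omega)) hifact hd hn hn).congr fun j hj => ?_
  exact h.cauchyProd_inv_factorial fun i hi => natCast_factorial_ne_zero (by omega)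

end

section

variable {K : Type*} [Field K] [CharP K 39541338091] {n d e nega fact ifact nfact cP cQ : ℕ}
  {a D : K} {p q : ℕ → K}

theorem Rep.double_shift (hL : d < 25 * 2 ^ e) (hdL : d + 1 + 25 * 2 ^ e ≤ blocks)
    (hd : d + 2 ≤ 2 ^ 17) (hn : n ≤ blocks) (ha : (nega : K) = -a)
    (hfact : Rep (2 ^ 36) blocks fact fun i => (i ! : K))
    (hifact : Rep (2 ^ 36) blocks ifact fun i => (i ! : K)⁻¹)
    (hnfact : Rep 39541338091 blocks nfact fun t => (-1) ^ t * (t ! : K)⁻¹)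
    {F G : K → K} (hp : IsNewton d F p) (hq : IsNewton d G q)
    (hP : Rep (2 ^ 36) (d + 1) cP p) (hQ : Rep (2 ^ 36) (d + 1) cQ q) {R Y : ℕ}
    (hR : R = chooseRevVec e nega nfact)
    (hY : Y = Nat.shiftRight (Nat.add (LeftFactorial.corr R fact cP)
      (Nat.shiftLeft (LeftFactorial.corr R fact cQ) 45))
      (Nat.mul 90 (Nat.pred (Nat.shiftLeft 25 e)))) :
    Rep (2 ^ 36) n (LeftFactorial.conv n (LeftFactorial.reduce
      (LeftFactorial.laneMul (Nat.land Y lowHalf) ifact)) ifact)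
      (fun j => F (j + a) * (j ! : K)⁻¹) ∧
    Rep (2 ^ 36) n (LeftFactorial.conv n (LeftFactorial.reduce
      (LeftFactorial.laneMul (Nat.land (Nat.shiftRight Y 45) lowHalf) ifact)) ifact)
      (fun j => G (j + a) * (j ! : K)⁻¹) := by
  have hRR := rep_chooseRevVec (K := K) (e := e) (by omega) ha hnfact
  rw [← hR] at hRR
  have hLs : Nat.shiftLeft 25 e = 25 * 2 ^ e := Nat.shiftLeft_eq _ _
  rw [hLs, Nat.pred_eq_sub_one] at hY
  have hpos := block_pos e
  generalize hLe : 25 * 2 ^ e = L at *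
  have hP' := hP.corr hfact hRR (by omega) hdL
  have hQ' := hQ.corr hfact hRR (by omega) hdL
  have h := hP'.halves hQ' (m := L - 1) (by omega) hdL hY
  have hm : d + 1 + L - (L - 1) = d + 2 := by omega
  rw [hm] at h
  exact ⟨Rep.shift hL hp h.1 hifact hd hn, Rep.shift hL hq h.2 hifact hd hn⟩

theorem double_spec (hL : d < 25 * 2 ^ e) (hdL : d + 1 + 25 * 2 ^ e ≤ blocks)
    (hd : d + 2 ≤ 2 ^ 17) (hn : n ≤ blocks) (ha : (nega : K) = -a) (haD : a * D = d)
    (hfact : Rep (2 ^ 36) blocks fact fun i => (i ! : K))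
    (hifact : Rep (2 ^ 36) blocks ifact fun i => (i ! : K)⁻¹)
    (hnfact : Rep 39541338091 blocks nfact fun t => (-1) ^ t * (t ! : K)⁻¹)
    (hp : IsNewton d (fun y => blockProd d (y * D)) p)
    (hq : IsNewton d (fun y => blockSum d (y * D)) q)
    (hP : Rep (2 ^ 36) (d + 1) cP p) (hQ : Rep (2 ^ 36) (d + 1) cQ q) (k : ℕ → ℕ → ℕ) :
    ∃ P Q, double fact ifact nfact n e nega cP cQ k = k P Q ∧
      Rep (2 ^ 36) n P (fun j => blockProd (2 * d) (j * D) * (j ! : K)⁻¹) ∧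
      Rep (2 ^ 36) n Q (fun j => blockSum (2 * d) (j * D) * (j ! : K)⁻¹) := by
  obtain ⟨R, Y, u, hR, hY, hu, h⟩ := double_eq (n := n) (e := e) (nega := nega)
    (fact := fact) (ifact := ifact) (nfact := nfact) (cP := cP) (cQ := cQ) k
  have hbl : blocks < 39541338091 := by norm_num [blocks]
  have h0 : ∀ j < n, (j ! : K) ≠ 0 := fun j hj => natCast_factorial_ne_zero (by omega)
  have hs := Rep.double_shift hL hdL hd hn ha hfact hifact hnfact hp hq hP hQ hR hY
  have hP0 := hP.conv (fun i _ hi => hp.1 i (by omega)) hifact (by omega) hn hn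
  have hQ0 := hQ.conv (fun i _ hi => hq.1 i (by omega)) hifact (by omega) hn hn
  have hU := hP0.reduce_laneMul hfact hn le_rfl
  rw [← hu] at hU
  have hU' : Rep (2 ^ 36) n u fun j => blockProd d (j * D) := hU.congr fun j hj => by
    rw [hp.cauchyProd_inv_factorial fun i hi => h0 i (by omega), inv_mul_cancel_right₀ (h0 j hj)]
  have hj : ∀ j : ℕ, ((j : K) + a) * D = j * D + d := fun j => by rw [add_mul, haD]
  refine ⟨_, _, h, (hs.1.reduce_laneMul hU' le_rfl hn).congr fun j _ => ?_,
    (((hQ0.add (hs.2.laneMul hU' le_rfl hn)).mono (by norm_num)).reduce hn).congr fun j hj' => ?_⟩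
  · rw [two_mul, blockProd_add, hj]
    ring
  · rw [two_mul, blockSum_add, hj,
      hq.cauchyProd_inv_factorial fun i hi => h0 i (by omega)]
    ring

end

/-- Iterates `double` until blocks of length `2 ^ (n + 1)` times the initial one are reached. -/
def loop (final : ℕ → ℕ → ℕ) (fact ifact nfact n : ℕ) : ℕ → ℕ → ℕ → ℕ → ℕ → ℕ :=
  Nat.rec
    (fun l _ nega cP cQ => double fact ifact nfact blocks (Nat.sub l 3) nega cP cQ final)
    (fun _ ih l d nega cP cQ =>
      double fact ifact nfact (Nat.succ (Nat.mul 2 d)) (Nat.sub l 3) nega cP cQ fun P Q =>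
        seqEval (conv (Nat.succ (Nat.mul 2 d)) P nfact) fun cP' =>
        seqEval (conv (Nat.succ (Nat.mul 2 d)) Q nfact) fun cQ' =>
        seqEval (Nat.succ l) fun l' => seqEval (Nat.mul 2 d) fun d' =>
        seqEval (Nat.mod (Nat.mul 2 nega) 39541338091) fun nega' => ih l' d' nega' cP' cQ') n

theorem loop_succ (final : ℕ → ℕ → ℕ) (fact ifact nfact n l d nega cP cQ : ℕ) :
    loop final fact ifact nfact (n + 1) l d nega cP cQ =
      double fact ifact nfact (2 * d + 1) (l - 3) nega cP cQ fun P Q =>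
        loop final fact ifact nfact n (l + 1) (2 * d) (2 * nega % 39541338091)
          (conv (2 * d + 1) P nfact) (conv (2 * d + 1) Q nfact) := by
  have h : ∀ P Q, (seqEval (conv (Nat.succ (Nat.mul 2 d)) P nfact) fun cP' =>
      seqEval (conv (Nat.succ (Nat.mul 2 d)) Q nfact) fun cQ' =>
      seqEval (Nat.succ l) fun l' => seqEval (Nat.mul 2 d) fun d' =>
      seqEval (Nat.mod (Nat.mul 2 nega) 39541338091) fun nega' =>
        loop final fact ifact nfact n l' d' nega' cP' cQ') =
      loop final fact ifact nfact n (l + 1) (2 * d) (2 * nega % 39541338091)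
        (conv (2 * d + 1) P nfact) (conv (2 * d + 1) Q nfact) := fun P Q => by
    rw [seqEval_eq, seqEval_eq, seqEval_eq, seqEval_eq, seqEval_eq]
    rfl
  exact congr_arg (double fact ifact nfact (2 * d + 1) (l - 3) nega cP cQ)
    (funext₂ h)

section

variable {K : Type*} [Field K] [CharP K 39541338091] {fact ifact nfact : ℕ} {D : K}

theorem loop_spec (final : ℕ → ℕ → ℕ)
    (hfact : Rep (2 ^ 36) blocks fact fun i => (i ! : K))
    (hifact : Rep (2 ^ 36) blocks ifact fun i => (i ! : K)⁻¹)
    (hnfact : Rep 39541338091 blocks nfact fun t => (-1) ^ t * (t ! : K)⁻¹)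
    (n : ℕ) {l d nega cP cQ : ℕ} {a : K} {p q : ℕ → K} (hl : n + l = 15) (hd : d = 3 * 2 ^ l)
    (ha : (nega : K) = -a) (haD : a * D = d)
    (hp : IsNewton d (fun y => blockProd d (y * D)) p)
    (hq : IsNewton d (fun y => blockSum d (y * D)) q)
    (hP : Rep (2 ^ 36) (d + 1) cP p) (hQ : Rep (2 ^ 36) (d + 1) cQ q) :
    ∃ P Q, loop final fact ifact nfact n l d nega cP cQ = final P Q ∧
      Rep (2 ^ 36) blocks P (fun j => blockProd 196608 (j * D) * (j ! : K)⁻¹) ∧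
      Rep (2 ^ 36) blocks Q (fun j => blockSum 196608 (j * D) * (j ! : K)⁻¹) := by
  have hside : d < 25 * 2 ^ (l - 3) ∧ d + 1 + 25 * 2 ^ (l - 3) ≤ 204800 ∧ d + 2 ≤ 2 ^ 17 := by
    have hl' : l ≤ 15 := by omega
    rw [hd]
    clear hl hd hfact hifact hnfact hP hQ hp hq haD
    interval_cases l <;> norm_num
  have hb : blocks = 204800 := rfl
  rw [← hb] at hside
  obtain ⟨h1, h2, h3⟩ := hside
  induction n generalizing l d nega cP cQ a p q with
  | zero =>
    have hd' : 2 * d = 196608 := by rw [hd, show l = 15 by omega]; norm_num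
    have h := double_spec h1 h2 h3 le_rfl ha haD hfact hifact hnfact hp hq hP hQ final
    rw [hd'] at h
    exact h
  | succ n ih =>
    have hl' : l ≤ 14 := by omega
    have hside : 2 * d < 25 * 2 ^ (l + 1 - 3) ∧ 2 * d + 1 + 25 * 2 ^ (l + 1 - 3) ≤ blocks ∧
        2 * d + 2 ≤ 2 ^ 17 := by
      rw [hd, hb]
      clear hl hd hfact hifact hnfact hP hQ hp hq haD ih h1 h2 h3
      interval_cases l <;> norm_num
    obtain ⟨h1', h2', h3'⟩ := hside
    obtain ⟨P, Q, h, hP', hQ'⟩ := double_spec (n := 2 * d + 1) h1 h2 h3 (by omega) ha haD hfact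
      hifact hnfact hp hq hP hQ fun P Q =>
        loop final fact ifact nfact n (l + 1) (2 * d) (2 * nega % 39541338091)
          (conv (2 * d + 1) P nfact) (conv (2 * d + 1) Q nfact)
    obtain ⟨p', hp'⟩ := exists_isNewton_blockProd (2 * d) D
    obtain ⟨q', hq'⟩ := exists_isNewton_blockSum (2 * d) D
    have hnf := hnfact.mono (by norm_num : 39541338091 ≤ 2 ^ 36)
    have hbl : blocks < 39541338091 := by norm_num [blocks]
    have hbl' : 2 * d + 1 ≤ blocks := by omega
    rw [loop_succ, h]
    refine ih (a := 2 * a) (p := p') (q := q') (by omega) (by rw [hd, pow_succ]; ring) ?_ ?_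
      hp' hq' ?_ ?_ h1' h2' h3'
    · rw [← CharP.cast_eq_mod, Nat.cast_mul, ha]
      push_cast
      ring
    · rw [mul_assoc, haD]
      push_cast
      rfl
    · refine (hP'.conv (fun i hi hi' => absurd hi (by omega)) hnf (by omega) hbl' hbl').congr
        fun j hj => ?_
      exact hp'.cauchyProd_alternating fun i hi => natCast_factorial_ne_zero (by omega)
    · refine (hQ'.conv (fun i hi hi' => absurd hi (by omega)) hnf (by omega) hbl' hbl').congr
        fun j hj => ?_
      exact hq'.cauchyProd_alternating fun i hi => natCast_factorial_ne_zero (by omega)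

theorem rep_flipOdd {X : ℕ} {f : ℕ → K} (hX : Rep 39541338091 blocks X fun t => (-1) ^ t * f t) :
    Rep (2 ^ 36) blocks (flipOdd X) f := by
  obtain ⟨v, hXv, hv⟩ := hX
  rw [hXv, flipOdd_pack fun i hi => (hv i hi).1]
  refine ⟨_, rfl, fun i hi => ⟨?_, ?_⟩⟩
  · have := (hv i hi).1
    split_ifs <;> omega
  · have h1 := (hv i hi).2
    beta_reduce at h1 ⊢
    split_ifs with h
    · rw [h1, (Nat.even_iff.2 h).neg_one_pow, one_mul]
    · rw [Nat.cast_sub (hv i hi).1.le, CharP.cast_eq_zero K 39541338091, h1,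
        (Nat.odd_iff.2 (by omega)).neg_one_pow]
      ring

end

/-- Reads off the sum of factorials from the values of block products and block sums divided by
factorials. -/
def total (fact P Q : ℕ) : ℕ :=
  Nat.mod (Nat.mod (laneMul (scanVec 13 (reduce (laneMul P fact)) 1) (reduce (laneMul Q fact)))
    (2 ^ 90 - 1)) 39541338091

/-- The left factorial of `39541338091` modulo `39541338091`. The three large literals are
`-3 / 196608` and the Newton coefficients of the products and sums of length `3`. -/
def leftFactorialMod : ℕ :=
  seqEval (risingVec 13 1 1) fun fact =>
  seqEval (risingRevVec 13 39541133292 3346025081) fun nfact =>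
  seqEval (flipOdd nfact) fun ifact =>
  loop (total fact) fact ifact nfact 15 0 3 29773657391
    35536110598317960382473555395372268043107405204554164109807039414532360060983834535656423430
    59238164063563417517578890619917799583296437867526278718704058372

theorem pack_modEq (n : ℕ) (f : ℕ → ℕ) : pack n f ≡ ∑ i ∈ range n, f i [MOD 2 ^ 90 - 1] := by
  induction n with
  | zero => rfl
  | succ n ih =>
    rw [pack_succ, sum_range_succ, pow_mul]
    have h : (2 ^ 90) ^ n ≡ 1 ^ n [MOD 2 ^ 90 - 1] :=
      ((Nat.modEq_iff_dvd' Nat.one_le_two_pow).2 dvd_rfl).symm.pow n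
    rw [one_pow] at h
    simpa using ih.add (h.mul_left (f n))

section

variable {K : Type*} [Field K] {X P Q fact : ℕ} {f g : ℕ → K}

theorem Rep.natCast_mod (hX : Rep (2 ^ 72) blocks X f) :
    ((X % (2 ^ 90 - 1) : ℕ) : K) = ∑ i ∈ range blocks, f i := by
  obtain ⟨v, hXv, hv⟩ := hX
  have h : ∑ i ∈ range blocks, v i < 2 ^ 90 - 1 :=
    calc ∑ i ∈ range blocks, v i ≤ ∑ _i ∈ range blocks, 2 ^ 72 :=
          sum_le_sum fun i hi => (hv i (mem_range.1 hi)).1.le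
      _ = blocks * 2 ^ 72 := by rw [sum_const, card_range, smul_eq_mul]
      _ < 2 ^ 90 - 1 := by norm_num [blocks]
  rw [hXv, pack_modEq blocks v, Nat.mod_eq_of_lt h, Nat.cast_sum]
  exact sum_congr rfl fun i hi => (hv i (mem_range.1 hi)).2

variable [CharP K 39541338091]

theorem Rep.scanVec (hX : Rep (2 ^ 36) blocks X f) :
    Rep (2 ^ 36) blocks (scanVec 13 X 1) fun i => ∏ j ∈ range i, f j := by
  obtain ⟨v, hXv, hv⟩ := hX
  have hb : blocks = 25 * 2 ^ 13 := rfl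
  rw [hXv]
  rw [hb] at hv ⊢
  rw [scanVec_eq 13 (by norm_num) fun i hi => (hv i hi).1.trans (by norm_num)]
  refine (rep_runProd v (by norm_num) _).congr fun i hi => ?_
  rw [Nat.cast_one, one_mul]
  exact prod_congr rfl fun j hj => (hv j ((mem_range.1 hj).trans hi)).2

theorem natCast_total {D : ℕ} (hfact : Rep (2 ^ 36) blocks fact fun i => (i ! : K))
    (hP : Rep (2 ^ 36) blocks P fun j => blockProd D ((j : K) * D) * (j ! : K)⁻¹)
    (hQ : Rep (2 ^ 36) blocks Q fun j => blockSum D ((j : K) * D) * (j ! : K)⁻¹)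
    (hD : 39541338091 ≤ blocks * D) :
    (total fact P Q : K) = (∑ i ∈ range 39541338091, i ! : ℕ) := by
  have hbl : blocks < 39541338091 := by norm_num [blocks]
  have h0 : ∀ j < blocks, (j ! : K) ≠ 0 := fun j hj => natCast_factorial_ne_zero (by omega)
  have hP' := (hP.reduce_laneMul hfact le_rfl le_rfl).congr fun j hj =>
    inv_mul_cancel_right₀ (h0 j hj) _
  have hQ' := (hQ.reduce_laneMul hfact le_rfl le_rfl).congr fun j hj =>
    inv_mul_cancel_right₀ (h0 j hj) _
  have h := (hP'.scanVec.laneMul hQ' le_rfl le_rfl).natCast_mod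
  have hsum : ∑ i ∈ range blocks, (∏ j ∈ range i, blockProd D ((j : K) * D)) *
      blockSum D ((i : K) * D) = ∑ i ∈ range (blocks * D), (i ! : K) := by
    rw [← sum_factorial_mul_blockSum]
    exact sum_congr rfl fun i _ => by rw [prod_blockProd]
  rw [Nat.cast_sum, sum_subset (range_subset_range.2 hD), ← hsum, ← h]
  · exact (CharP.cast_eq_mod K 39541338091 _).symm
  · intro i _ hi
    rw [CharP.cast_eq_zero_iff K 39541338091, prime_39541338091.dvd_factorial]
    simpa using hi

theorem rep_getD (w : List ℕ) :
    Rep (2 ^ 36) n (pack n fun i => w.getD i 0 % 39541338091) fun i => (w.getD i 0 : K) :=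
  ⟨_, rfl, fun i _ => ⟨(Nat.mod_lt _ (by norm_num)).trans (by norm_num),
    (CharP.cast_eq_mod K 39541338091 _).symm⟩⟩

omit [CharP K 39541338091] in
theorem isNewton_blockProd_three (D : ℕ) : IsNewton 3 (fun y : K => blockProd 3 (y * D)) fun i =>
    (([6, D ^ 3 + 6 * D ^ 2 + 11 * D, 3 * D ^ 3 + 6 * D ^ 2, D ^ 3].getD i 0 : ℕ) : K) := by
  refine ⟨fun i hi => ?_, fun y => ?_⟩
  · beta_reduce
    rw [List.getD_eq_default, Nat.cast_zero]
    exact hi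
  · simp [blockProd, fall, sum_range_succ, prod_range_succ]
    ring

omit [CharP K 39541338091] in
theorem isNewton_blockSum_three (D : ℕ) : IsNewton 3 (fun y : K => blockSum 3 (y * D)) fun i =>
    (([4, D ^ 2 + 4 * D, D ^ 2].getD i 0 : ℕ) : K) := by
  refine ⟨fun i hi => ?_, fun y => ?_⟩
  · beta_reduce
    rw [List.getD_eq_default, Nat.cast_zero]
    exact hi.le
  · simp [blockProd, blockSum, fall, sum_range_succ, prod_range_succ]
    ring

set_option exponentiation.threshold 300 in
variable (K) in
theorem natCast_leftFactorialMod
    (h : Nat.land (risingRevVec 13 39541133292 3346025081) (2 ^ 90 - 1) = 1) :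
    (leftFactorialMod : K) = (∑ i ∈ range 39541338091, i ! : ℕ) := by
  have hnfact := rep_sign_inv_factorial (K := K) (by norm_num) h
  have hifact := rep_flipOdd hnfact
  have hfact := rep_factorial (K := K)
  have hP := rep_getD (K := K) (n := 4)
    [6, 196608 ^ 3 + 6 * 196608 ^ 2 + 11 * 196608, 3 * 196608 ^ 3 + 6 * 196608 ^ 2, 196608 ^ 3]
  have hQ := rep_getD (K := K) (n := 4) [4, 196608 ^ 2 + 4 * 196608, 196608 ^ 2]
  have ha : (9767680700 : ℕ) * (196608 : ℕ) = ((3 : ℕ) : K) := by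
    rw [← Nat.cast_mul, CharP.natCast_eq_natCast K 39541338091]
    norm_num [Nat.ModEq]
  have hna : ((29773657391 : ℕ) : K) = -(9767680700 : ℕ) := by
    rw [eq_neg_iff_add_eq_zero, ← Nat.cast_add]
    exact CharP.cast_eq_zero K 39541338091
  have hp4 : pack 4 (fun i => [6, 196608 ^ 3 + 6 * 196608 ^ 2 + 11 * 196608,
      3 * 196608 ^ 3 + 6 * 196608 ^ 2, 196608 ^ 3].getD i 0 % 39541338091) =
      35536110598317960382473555395372268043107405204554164109807039414532360060983834535656423430
      := by
    norm_num [pack, sum_range_succ]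
  have hq4 : pack 4 (fun i => [4, 196608 ^ 2 + 4 * 196608, 196608 ^ 2].getD i 0 % 39541338091) =
      59238164063563417517578890619917799583296437867526278718704058372 := by
    norm_num [pack, sum_range_succ]
  rw [hp4] at hP
  rw [hq4] at hQ
  rw [leftFactorialMod, seqEval_eq, seqEval_eq, seqEval_eq]
  obtain ⟨P, Q, hl, hP', hQ'⟩ := loop_spec (K := K) (total (risingVec 13 1 1)) hfact hifact hnfact
    15 (l := 0) (by norm_num) (by norm_num) hna ha (isNewton_blockProd_three 196608)
    (isNewton_blockSum_three 196608) hP hQ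
  rw [hl]
  exact natCast_total hfact (D := 196608) hP' hQ' (by norm_num [blocks])

end

theorem land_risingRevVec :
    Nat.beq (Nat.land (risingRevVec 13 39541133292 3346025081) (2 ^ 90 - 1)) 1 = true := by
  decide +kernel

theorem leftFactorialMod_beq : Nat.beq leftFactorialMod 39541338090 = true := by
  decide +kernel

end LeftFactorial

/-- The prime `p = 39541338091` satisfies `!p ≡ -1 (mod p)`, i.e. `p` divides
`!p + 1`, where `!p = 0! + 1! + ⋯ + (p-1)!`. -/
theorem left_factorial_residue_39541338091 :
    Nat.Prime 39541338091 ∧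
      (39541338091 : ℕ) ∣ (∑ i ∈ Finset.range 39541338091, i.factorial) + 1 := by
  have hp := LeftFactorial.prime_39541338091
  refine ⟨hp, ?_⟩
  have : Fact (Nat.Prime 39541338091) := ⟨hp⟩
  have h := LeftFactorial.natCast_leftFactorialMod (ZMod 39541338091)
    (Nat.eq_of_beq_eq_true LeftFactorial.land_risingRevVec)
  rw [Nat.eq_of_beq_eq_true LeftFactorial.leftFactorialMod_beq] at h
  rw [← CharP.cast_eq_zero_iff (ZMod 39541338091), Nat.cast_add, ← h, ← Nat.cast_add]
  exact CharP.cast_eq_zero (ZMod 39541338091) 39541338091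
end
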